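/- Let V = (e^{ia}, e^{ib}) be an open arc of 𝕋 and let f ∈ D(μ) ∩ H^∞ be an outer function. Let f_V be the outer function with boundary modulus |f_V(ζ)| = |(ζ − e^{ia})(e^{ib} − ζ)|·|f(ζ)| a.e. on the closed arc V̄ and |f_V(ζ)| = |(ζ − e^{ia})(e^{ib} − ζ)| on 𝕋∖V̄. Then f_V ∈ D(μ) ∩ H^∞. -/

import Mathlib

open MeasureTheory Metric Filter Complex Set
open scoped ENNReal Topology

noncomputable section

namespace DirichletMu

/-- The open unit disc in `ℂ`. -/
def disc : Set ℂ := Metric.ball 0 1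

/-- The unit circle `𝕋`. -/
def circleT : Set ℂ := Metric.sphere 0 1

/-- The boundary point `e^{it}`. -/
def bpt (t : ℝ) : ℂ := Complex.exp (Complex.I * (t : ℂ))

/-- Arc-length parametrizing measure on `(0, 2π]`. -/
def θm : Measure ℝ := volume.restrict (Set.Ioc 0 (2 * Real.pi))

/-- A measure is carried by the unit circle. -/
def OnCircle (μ : Measure ℂ) : Prop := μ circleTᶜ = 0

/-- The mean-square integrals of `f` over circles of radius `r < 1`. -/
def hardySet (f : ℂ → ℂ) : Set ℝ :=
  {x | ∃ r : ℝ, 0 < r ∧ r < 1 ∧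
    x = (1 / (2 * Real.pi)) * ∫ t in (0:ℝ)..(2 * Real.pi), ‖f ((r : ℂ) * bpt t)‖ ^ 2}

/-- Membership in the Hardy space `H²`. -/
def MemHardy2 (f : ℂ → ℂ) : Prop :=
  DifferentiableOn ℂ f disc ∧ BddAbove (hardySet f)

/-- The squared Hardy norm. -/
def hardyNormSq (f : ℂ → ℂ) : ℝ := sSup (hardySet f)

/-- Membership in `H^∞`. -/
def MemHinf (f : ℂ → ℂ) : Prop :=
  DifferentiableOn ℂ f disc ∧ ∃ C : ℝ, ∀ z ∈ disc, ‖f z‖ ≤ C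

/-- The sup norm over the disc. -/
def supNorm (f : ℂ → ℂ) : ℝ := sSup ((fun z => ‖f z‖) '' disc)

/-- The Poisson integral of the measure `μ`. -/
def poissonMu (μ : Measure ℂ) (z : ℂ) : ℝ :=
  ∫ ζ, (1 - ‖z‖ ^ 2) / ‖1 - (starRingEnd ℂ) ζ * z‖ ^ 2 ∂μ

/-- The integrand of the Dirichlet integral. -/
def dirichletDensity (μ : Measure ℂ) (f : ℂ → ℂ) (z : ℂ) : ℝ :=
  ‖deriv f z‖ ^ 2 * poissonMu μ z

/-- The Dirichlet integral `D_μ(f)`. -/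
def dirichletIntegral (μ : Measure ℂ) (f : ℂ → ℂ) : ℝ :=
  (1 / Real.pi) * ∫ z in disc, dirichletDensity μ f z

/-- Membership in the Dirichlet-type space `D(μ)`. -/
def MemD (μ : Measure ℂ) (f : ℂ → ℂ) : Prop :=
  MemHardy2 f ∧ IntegrableOn (dirichletDensity μ f) disc

/-- The squared norm `‖f‖_μ²` of `D(μ)`. -/
def dNormSq (μ : Measure ℂ) (f : ℂ → ℂ) : ℝ :=
  hardyNormSq f + dirichletIntegral μ f

/-- `f` has radial limit `L` at `ζ`. -/
def HasRadialLimitAt (f : ℂ → ℂ) (ζ L : ℂ) : Prop :=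
  Tendsto (fun r : ℝ => f ((r : ℂ) * ζ)) (nhdsWithin 1 (Set.Iio 1)) (nhds L)

/-- The modulus of `f` has radial limit `m` at `e^{it}`. -/
def BoundaryAbs (f : ℂ → ℂ) (t : ℝ) (m : ℝ) : Prop :=
  Tendsto (fun r : ℝ => ‖f ((r : ℂ) * bpt t)‖) (nhdsWithin 1 (Set.Iio 1)) (nhds m)

/-- The boundary zero set `Z_𝕋(f)`. -/
def ZT (f : ℂ → ℂ) : Set ℂ :=
  {ζ | ζ ∈ circleT ∧ HasRadialLimitAt f ζ 0}

/-- The set `Z̲(f)`. -/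
def Zlow (f : ℂ → ℂ) : Set ℂ :=
  {ζ | ζ ∈ Metric.closedBall (0 : ℂ) 1 ∧
    Filter.liminf (fun z => ‖f z‖) (nhdsWithin ζ disc) = 0}

def ZlowSet (S : Set (ℂ → ℂ)) : Set ℂ := ⋂ f ∈ S, Zlow f

def ZTSet (S : Set (ℂ → ℂ)) : Set ℂ := ⋂ f ∈ S, ZT f

/-- `[f]_{D(μ)}`: the closure in `D(μ)` of the polynomial multiples of `f`. -/
def closedSpan (μ : Measure ℂ) (f : ℂ → ℂ) : Set (ℂ → ℂ) :=
  {g | MemD μ g ∧ ∀ ε > 0, ∃ q : Polynomial ℂ,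
    dNormSq μ (fun z => g z - q.eval z * f z) < ε}

/-- `f` is cyclic for `D(μ)`. -/
def IsCyclic (μ : Measure ℂ) (f : ℂ → ℂ) : Prop :=
  closedSpan μ f = {g | MemD μ g}

/-- `f` is the outer function with boundary modulus `φ` (parametrized by `e^{it}`). -/
def OuterWith (f : ℂ → ℂ) (φ : ℝ → ℝ) : Prop :=
  (∀ t, 0 ≤ φ t) ∧
  IntervalIntegrable (fun t => Real.log (φ t)) volume 0 (2 * Real.pi) ∧
  ∀ z ∈ disc, f z = Complex.exp (((2 * Real.pi : ℝ) : ℂ)⁻¹ *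
    ∫ t in (0:ℝ)..(2 * Real.pi), ((bpt t + z) / (bpt t - z)) * (Real.log (φ t) : ℂ))

/-- `f` is an outer function. -/
def IsOuter (f : ℂ → ℂ) : Prop := ∃ φ, OuterWith f φ

/-- Inner functions. -/
def IsInner (f : ℂ → ℂ) : Prop :=
  DifferentiableOn ℂ f disc ∧ (∀ z ∈ disc, ‖f z‖ ≤ 1) ∧
  ∀ᵐ t ∂θm, BoundaryAbs f t 1

/-- `f / Θ ∈ H²`. -/
def InnerDivides (Θ f : ℂ → ℂ) : Prop :=
  ∃ g, MemHardy2 g ∧ ∀ z ∈ disc, f z = Θ z * g z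

/-- `Θ / Θ'` is bounded on the disc. -/
def DividesBdd (Θ' Θ : ℂ → ℂ) : Prop :=
  ∃ g, MemHinf g ∧ ∀ z ∈ disc, Θ z = Θ' z * g z

/-- `Θ` is the greatest common inner divisor of the family `M`. -/
def IsGCDInner (M : Set (ℂ → ℂ)) (Θ : ℂ → ℂ) : Prop :=
  IsInner Θ ∧ (∀ f ∈ M, InnerDivides Θ f) ∧
  ∀ Θ', IsInner Θ' → (∀ f ∈ M, InnerDivides Θ' f) → DividesBdd Θ' Θ

/-- The set `Θ H²`. -/
def innerMulH2 (Θ : ℂ → ℂ) : Set (ℂ → ℂ) :=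
  {h | ∃ g, MemHardy2 g ∧ ∀ z ∈ disc, h z = Θ z * g z}

/-- Poisson extension of a boundary function (parametrized by `e^{it}`). -/
def poissonExt (u : ℝ → ℝ) (z : ℂ) : ℝ :=
  (1 / (2 * Real.pi)) * ∫ t in (0:ℝ)..(2 * Real.pi),
    ((1 - ‖z‖ ^ 2) / ‖bpt t - z‖ ^ 2) * u t

/-- `|∇ P[u]|² P_μ`. -/
def gradDensity (μ : Measure ℂ) (u : ℝ → ℝ) (z : ℂ) : ℝ :=
  ‖fderiv ℝ (poissonExt u) z‖ ^ 2 * poissonMu μ z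

/-- Membership in the harmonic Dirichlet space `D^h(μ)`. -/
def MemDh (μ : Measure ℂ) (u : ℝ → ℝ) : Prop :=
  IntegrableOn (fun t => (u t) ^ 2) (Set.Ioc 0 (2 * Real.pi)) volume ∧
  IntegrableOn (gradDensity μ u) disc

/-- The squared norm of `D^h(μ)`. -/
def dhNormSq (μ : Measure ℂ) (u : ℝ → ℝ) : ℝ :=
  (1 / (2 * Real.pi)) * (∫ t in Set.Ioc 0 (2 * Real.pi), (u t) ^ 2) +
  (1 / Real.pi) * ∫ z in disc, gradDensity μ u z

/-- Relatively open subsets of the circle. -/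
def RelOpen (U : Set ℂ) : Prop := ∃ V : Set ℂ, IsOpen V ∧ U = V ∩ circleT

/-- Capacity of a relatively open subset of the circle. -/
def capOpen (μ : Measure ℂ) (U : Set ℂ) : ℝ≥0∞ :=
  ⨅ (u : ℝ → ℝ) (_ : MemDh μ u ∧ (∀ t, 0 ≤ u t) ∧
      ∀ᵐ t ∂θm, bpt t ∈ U → 1 ≤ u t),
    ENNReal.ofReal (dhNormSq μ u)

/-- The capacity `c_μ` of an arbitrary subset of the circle. -/
def cap (μ : Measure ℂ) (F : Set ℂ) : ℝ≥0∞ :=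
  ⨅ (U : Set ℂ) (_ : RelOpen U ∧ F ⊆ U), capOpen μ U

/-- The (closed) support of a measure on `ℂ`. -/
def msupport (μ : Measure ℂ) : Set ℂ :=
  {x | ∀ r > 0, 0 < μ (Metric.ball x r)}

/-- `M_μ(E)`: functions of `D(μ)` whose radial limits vanish `c_μ`-q.e. on `E`. -/
def Mspace (μ : Measure ℂ) (E : Set ℂ) : Set (ℂ → ℂ) :=
  {g | MemD μ g ∧ ∃ N : Set ℂ, cap μ N = 0 ∧ ∀ ζ ∈ E \ N, HasRadialLimitAt g ζ 0}

/-- Closed shift-invariant subspaces of `D(μ)` (closedness for the `D(μ)` norm). -/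
structure ClosedInvSubspace (μ : Measure ℂ) (M : Set (ℂ → ℂ)) : Prop where
  subset : M ⊆ {f | MemD μ f}
  zero_mem : (fun _ => (0 : ℂ)) ∈ M
  add_mem : ∀ f ∈ M, ∀ g ∈ M, (fun z => f z + g z) ∈ M
  smul_mem : ∀ (c : ℂ), ∀ f ∈ M, (fun z => c * f z) ∈ M
  shift_mem : ∀ f ∈ M, (fun z => z * f z) ∈ M
  closed : ∀ g, MemD μ g →
    (∀ ε > 0, ∃ h ∈ M, dNormSq μ (fun z => g z - h z) < ε) → g ∈ M

/-- The norm `‖f‖_{∞,μ}` of the Banach algebra `D(μ) ∩ H^∞`. -/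
def algNorm (μ : Measure ℂ) (f : ℂ → ℂ) : ℝ :=
  supNorm f + Real.sqrt (dirichletIntegral μ f)

/-- Membership in the Banach algebra `D(μ) ∩ H^∞`. -/
def MemA (μ : Measure ℂ) (f : ℂ → ℂ) : Prop := MemD μ f ∧ MemHinf f

/-- Closed ideals of `D(μ) ∩ H^∞`. -/
structure ClosedIdeal (μ : Measure ℂ) (J : Set (ℂ → ℂ)) : Prop where
  subset : J ⊆ {f | MemA μ f}
  zero_mem : (fun _ => (0 : ℂ)) ∈ J
  add_mem : ∀ f ∈ J, ∀ g ∈ J, (fun z => f z + g z) ∈ J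
  mul_mem : ∀ f, MemA μ f → ∀ g ∈ J, (fun z => f z * g z) ∈ J
  closed : ∀ g, MemA μ g →
    (∀ ε > 0, ∃ h ∈ J, algNorm μ (fun z => g z - h z) < ε) → g ∈ J

/-- A multiplier of `D(μ)`. -/
def IsMultiplier (μ : Measure ℂ) (φ : ℂ → ℂ) : Prop :=
  DifferentiableOn ℂ φ disc ∧ ∀ g, MemD μ g → MemD μ (fun z => φ z * g z)

/-- Distance between two subsets of `ℂ`. -/
def setDist (A B : Set ℂ) : ℝ :=
  sInf ((fun p : ℂ × ℂ => dist p.1 p.2) '' (A ×ˢ B))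

lemma measurableSet_disc : MeasurableSet disc := Metric.isOpen_ball.measurableSet

lemma hasSum_sq_coeff_circleAverage {a : ℕ → ℂ} {G : ℂ → ℂ}
    (h : ∀ z ∈ disc, HasSum (fun n => a n * z ^ n) (G z)) {r : ℝ} (hr0 : 0 ≤ r) (hr : r < 1) :
    HasSum (fun n => ‖a n‖ ^ 2 * r ^ (2 * n)) (Real.circleAverage (fun z => ‖G z‖ ^ 2) 0 r) := by
  have hrd : (r : ℂ) ∈ disc := by simp [disc, abs_of_nonneg hr0, hr]
  have hs : Summable (fun n => ‖a n‖ * r ^ n) := by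
    have := (h r hrd).summable.norm
    simpa [norm_mul, norm_pow, abs_of_nonneg hr0] using this
  set p : ℕ → Polynomial ℂ := fun N =>
    ∑ n ∈ Finset.range N, Polynomial.monomial n (a n * (r : ℂ) ^ n) with hp
  have hpe : ∀ N z, (p N).eval z = ∑ n ∈ Finset.range N, a n * (r : ℂ) ^ n * z ^ n := by
    intro N z
    simp [hp, Polynomial.eval_finsetSum]
  have hpc : ∀ N n, (p N).coeff n = if n < N then a n * (r : ℂ) ^ n else 0 := by
    intro N n
    simp [hp, Polynomial.coeff_monomial]
  have hsum : ∀ N, ∑ n ∈ Finset.range N, ‖a n‖ ^ 2 * r ^ (2 * n) =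
      Real.circleAverage (fun z => ‖(p N).eval z‖ ^ 2) 0 1 := by
    intro N
    rw [← Polynomial.sum_sq_norm_coeff_eq_circleAverage]
    have hsub : (p N).support ⊆ Finset.range N := by
      intro n hn
      rw [Polynomial.mem_support_iff, hpc] at hn
      by_contra hc
      simp at hc
      simp [not_lt.mpr hc] at hn
    rw [Finset.sum_subset hsub (fun n _ hn => by
      rw [Polynomial.notMem_support_iff.mp hn]; simp)]
    refine Finset.sum_congr rfl fun n hn => ?_
    rw [hpc, if_pos (Finset.mem_range.mp hn), norm_mul, norm_pow, Complex.norm_real,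
      Real.norm_of_nonneg hr0]
    ring
  rw [hasSum_iff_tendsto_nat_of_nonneg (fun n => by positivity)]
  simp_rw [hsum]
  rw [Real.circleAverage_eq_circleAverage_zero_one]
  unfold Real.circleAverage
  refine Tendsto.const_smul ?_ _
  refine intervalIntegral.tendsto_integral_filter_of_dominated_convergence
    (fun _ => (∑' n, ‖a n‖ * r ^ n) ^ 2) ?_ ?_ ?_ ?_
  · refine Eventually.of_forall fun N => ?_
    exact (by fun_prop : Continuous fun θ => ‖(p N).eval (circleMap 0 1 θ)‖ ^ 2).aestronglyMeasurable
  · refine Eventually.of_forall fun N => ae_of_all _ fun θ _ => ?_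
    rw [Real.norm_of_nonneg (by positivity)]
    beta_reduce
    rw [hpe]
    gcongr
    calc ‖∑ n ∈ Finset.range N, a n * (r : ℂ) ^ n * circleMap 0 1 θ ^ n‖
        ≤ ∑ n ∈ Finset.range N, ‖a n * (r : ℂ) ^ n * circleMap 0 1 θ ^ n‖ := norm_sum_le _ _
      _ = ∑ n ∈ Finset.range N, ‖a n‖ * r ^ n := by
        refine Finset.sum_congr rfl fun n _ => ?_
        simp [abs_of_nonneg hr0]
      _ ≤ _ := hs.sum_le_tsum _ (fun n _ => by positivity)
  · simp
  · refine ae_of_all _ fun θ _ => ?_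
    refine Tendsto.pow (Tendsto.norm ?_) 2
    simp_rw [hpe]
    have hm : (r : ℂ) * circleMap 0 1 θ ∈ disc := by simp [disc, abs_of_nonneg hr0, hr]
    have := (h _ hm).tendsto_sum_nat
    simpa [mul_pow, mul_assoc] using this

/-- Taylor coefficients at the origin. -/
def taylorCoeff (G : ℂ → ℂ) (n : ℕ) : ℂ := (n.factorial : ℂ)⁻¹ * iteratedDeriv n G 0

lemma taylorCoeff_zero (G : ℂ → ℂ) : taylorCoeff G 0 = G 0 := by simp [taylorCoeff]

lemma hasSum_taylorCoeff {G : ℂ → ℂ} (hG : DifferentiableOn ℂ G disc) {z : ℂ} (hz : z ∈ disc) :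
    HasSum (fun n => taylorCoeff G n * z ^ n) (G z) := by
  have := Complex.hasSum_taylorSeries_on_ball (c := 0) (r := 1) hG hz
  simp only [sub_zero, smul_eq_mul] at this
  refine this.congr_fun fun n => ?_
  simp [taylorCoeff]; ring

lemma taylorCoeff_deriv (G : ℂ → ℂ) (n : ℕ) :
    taylorCoeff (deriv G) n = (n + 1) * taylorCoeff G (n + 1) := by
  have : (n.factorial : ℂ) ≠ 0 := by exact_mod_cast n.factorial_ne_zero
  have h2 : (n : ℂ) + 1 ≠ 0 := by exact_mod_cast n.succ_ne_zero
  simp only [taylorCoeff, Nat.factorial_succ, iteratedDeriv_succ']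
  push_cast
  field_simp

lemma hasSum_deriv_taylorCoeff {G : ℂ → ℂ} (hG : DifferentiableOn ℂ G disc) {z : ℂ}
    (hz : z ∈ disc) :
    HasSum (fun n : ℕ => (((n : ℂ) + 1) * taylorCoeff G (n + 1)) * z ^ n) (deriv G z) := by
  have := hasSum_taylorCoeff (hG.deriv Metric.isOpen_ball) hz
  simpa only [taylorCoeff_deriv] using this

lemma integral_Ioo_neg_pi_pi_eq_circleAverage (F : ℂ → ℝ) (r : ℝ) :
    ∫ θ in Ioo (-Real.pi) Real.pi, F (r * (Real.cos θ + Real.sin θ * I)) =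
      2 * Real.pi * Real.circleAverage F 0 r := by
  rw [Real.circleAverage_eq_integral_add (-Real.pi), smul_eq_mul, ← mul_assoc,
    mul_inv_cancel₀ (by positivity), one_mul,
    intervalIntegral.integral_comp_add_right (fun θ => F (circleMap 0 r θ)),
    ← integral_Ioc_eq_integral_Ioo, ← intervalIntegral.integral_of_le (by linarith [Real.pi_pos])]
  have h1 : (0 : ℝ) + -Real.pi = -Real.pi := by ring
  have h2 : 2 * Real.pi + -Real.pi = Real.pi := by ring
  rw [h1, h2]
  refine intervalIntegral.integral_congr fun θ _ => ?_
  simp [circleMap, Complex.exp_mul_I]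

lemma lintegral_Ioo_weight (n : ℕ) (c : ℝ) (hc : 0 ≤ c) :
    ∫⁻ r in Ioo (0 : ℝ) 1, ENNReal.ofReal (c * (r ^ (2 * n + 1) * (1 - r ^ 2))) =
      ENNReal.ofReal (c * (1 / (2 * (n + 1) * (n + 2)))) := by
  rw [← ofReal_integral_eq_lintegral_ofReal]
  · rw [← integral_Ioc_eq_integral_Ioo, ← intervalIntegral.integral_of_le zero_le_one]
    congr 1
    rw [intervalIntegral.integral_const_mul]
    congr 1
    have : ∀ r : ℝ, r ^ (2 * n + 1) * (1 - r ^ 2) = r ^ (2 * n + 1) - r ^ (2 * n + 3) := by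
      intro r; ring
    simp_rw [this]
    rw [intervalIntegral.integral_sub (Continuous.intervalIntegrable (by fun_prop) _ _)
      (Continuous.intervalIntegrable (by fun_prop) _ _), integral_pow, integral_pow]
    push_cast
    have h1 : (n : ℝ) + 1 ≠ 0 := by positivity
    have h2 : (n : ℝ) + 2 ≠ 0 := by positivity
    have h3 : (2 * n + 1 + 1 : ℝ) ≠ 0 := by positivity
    have h4 : (2 * n + 3 + 1 : ℝ) ≠ 0 := by positivity
    simp
    field_simp
    ring
  · exact (Continuous.integrableOn_Icc (by fun_prop)).mono_set Ioo_subset_Icc_self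
  · filter_upwards [ae_restrict_mem measurableSet_Ioo] with r hr
    have : r ^ 2 ≤ 1 := by nlinarith [hr.1, hr.2]
    have := hr.1
    simp only [Pi.zero_apply]
    refine mul_nonneg hc (mul_nonneg (by positivity) (by linarith))

/-- The weighted Dirichlet integral with weight `1 - |z|²` in terms of Taylor coefficients. -/
lemma lintegral_deriv_sq_weight {G : ℂ → ℂ} (hG : DifferentiableOn ℂ G disc) :
    ∫⁻ z in disc, ENNReal.ofReal (‖deriv G z‖ ^ 2 * (1 - ‖z‖ ^ 2)) =
      ∑' n : ℕ, ENNReal.ofReal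
        (Real.pi * (((n : ℝ) + 1) / (n + 2)) * ‖taylorCoeff G (n + 1)‖ ^ 2) := by
  have hdm : Measurable fun z => ENNReal.ofReal (‖deriv G z‖ ^ 2 * (1 - ‖z‖ ^ 2)) := by
    have := measurable_deriv G
    fun_prop
  have hdc : ContinuousOn (deriv G) disc := (hG.deriv Metric.isOpen_ball).continuousOn
  rw [← lintegral_indicator measurableSet_disc,
    ← Complex.lintegral_comp_polarCoord_symm]
  rw [show polarCoord.target = Ioi (0 : ℝ) ×ˢ Ioo (-Real.pi) Real.pi from rfl, Measure.volume_eq_prod,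
    setLIntegral_prod]
  swap
  · refine Measurable.aemeasurable ?_
    have hc : Continuous fun p : ℝ × ℝ => Complex.polarCoord.symm p := by
      simp_rw [Complex.polarCoord_symm_apply]
      fun_prop
    exact Measurable.mul (ENNReal.measurable_ofReal.comp measurable_fst)
      ((hdm.indicator measurableSet_disc).comp hc.measurable)
  have key : ∀ r ∈ Ioi (0 : ℝ), ∫⁻ θ in Ioo (-Real.pi) Real.pi, ENNReal.ofReal r •
      (disc.indicator (fun z => ENNReal.ofReal (‖deriv G z‖ ^ 2 * (1 - ‖z‖ ^ 2)))
        (Complex.polarCoord.symm (r, θ))) =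
      (Ioo (0 : ℝ) 1).indicator (fun r => ∑' n : ℕ, ENNReal.ofReal
        ((2 * Real.pi * ((n + 1) ^ 2 * ‖taylorCoeff G (n + 1)‖ ^ 2)) *
          (r ^ (2 * n + 1) * (1 - r ^ 2)))) r := by
    intro r hr
    have hr0 : 0 < r := hr
    by_cases h1 : r < 1
    · have hrI : r ∈ Ioo (0 : ℝ) 1 := ⟨hr0, h1⟩
      rw [indicator_of_mem hrI]
      have hn : ∀ θ : ℝ, ‖(r : ℂ) * (Real.cos θ + Real.sin θ * I)‖ = r := by
        intro θ
        rw [Complex.ofReal_cos, Complex.ofReal_sin, ← Complex.exp_mul_I, norm_mul,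
          Complex.norm_exp_ofReal_mul_I, mul_one, Complex.norm_real, Real.norm_of_nonneg hr0.le]
      have hd : ∀ θ : ℝ, (r : ℂ) * (Real.cos θ + Real.sin θ * I) ∈ disc := by
        intro θ
        simpa [disc] using (hn θ).trans_lt h1
      have hw : 0 ≤ 1 - r ^ 2 := by nlinarith
      have e1 : ∀ θ : ℝ, ENNReal.ofReal r •
          (disc.indicator (fun z => ENNReal.ofReal (‖deriv G z‖ ^ 2 * (1 - ‖z‖ ^ 2)))
            (Complex.polarCoord.symm (r, θ))) = ENNReal.ofReal
            (r * (1 - r ^ 2) * ‖deriv G (r * (Real.cos θ + Real.sin θ * I))‖ ^ 2) := by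
        intro θ
        rw [Complex.polarCoord_symm_apply, indicator_of_mem (hd θ), smul_eq_mul,
          ← ENNReal.ofReal_mul hr0.le, hn]
        ring_nf
      simp_rw [e1]
      rw [← ofReal_integral_eq_lintegral_ofReal, integral_const_mul,
        integral_Ioo_neg_pi_pi_eq_circleAverage (fun z => ‖deriv G z‖ ^ 2)]
      · have hS := hasSum_sq_coeff_circleAverage
          (fun z hz => hasSum_deriv_taylorCoeff hG hz) hr0.le h1
        have hS2 := hS.mul_left (r * (1 - r ^ 2) * (2 * Real.pi))
        have hS3 : HasSum (fun n : ℕ => (2 * Real.pi * ((n + 1) ^ 2 * ‖taylorCoeff G (n + 1)‖ ^ 2)) *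
          (r ^ (2 * n + 1) * (1 - r ^ 2))) (r * (1 - r ^ 2) * (2 * Real.pi *
            Real.circleAverage (fun z => ‖deriv G z‖ ^ 2) 0 r)) := by
          rw [← mul_assoc (r * (1 - r ^ 2))]
          refine hS2.congr_fun fun n => ?_
          · have : ‖((n : ℂ) + 1)‖ = (n : ℝ) + 1 := by
              rw [← Nat.cast_add_one, Complex.norm_natCast]; push_cast; rfl
            rw [norm_mul, this]
            ring
        rw [← hS3.tsum_eq, ENNReal.ofReal_tsum_of_nonneg _ hS3.summable]
        intro n; positivity
      · have : Continuous fun θ : ℝ => deriv G (r * (Real.cos θ + Real.sin θ * I)) :=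
          hdc.comp_continuous (by fun_prop) hd
        exact (Continuous.integrableOn_Icc (by fun_prop)).mono_set Ioo_subset_Icc_self
      · exact ae_of_all _ fun θ => mul_nonneg (mul_nonneg hr0.le hw) (by positivity)
    · rw [indicator_of_notMem (fun h => h1 h.2)]
      simp only [smul_eq_mul]
      rw [lintegral_eq_zero_iff' (by
        refine Measurable.aemeasurable (Measurable.const_mul ?_ _)
        refine (hdm.indicator measurableSet_disc).comp ?_
        simp_rw [Complex.polarCoord_symm_apply]
        fun_prop)]
      refine ae_of_all _ fun θ => ?_
      beta_reduce
      rw [indicator_of_notMem]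
      · simp
      · have := Complex.norm_polarCoord_symm (r, θ)
        simp only [disc, mem_ball_zero_iff, this, abs_of_pos hr0, h1, not_false_eq_true]
  rw [setLIntegral_congr_fun measurableSet_Ioi key, lintegral_indicator measurableSet_Ioo,
    Measure.restrict_restrict measurableSet_Ioo,
    inter_eq_left.mpr (Ioo_subset_Ioi_self), lintegral_tsum (fun n => by fun_prop)]
  refine tsum_congr fun n => ?_
  rw [lintegral_Ioo_weight n _ (by positivity)]
  congr 1
  field_simp

/-- Upper Littlewood–Paley inequality. -/
lemma lintegral_deriv_sq_weight_le {G : ℂ → ℂ} (hG : DifferentiableOn ℂ G disc) {M : ℝ}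
    (hM : ∀ r : ℝ, 0 < r → r < 1 → Real.circleAverage (fun z => ‖G z‖ ^ 2) 0 r ≤ M) :
    ∫⁻ z in disc, ENNReal.ofReal (‖deriv G z‖ ^ 2 * (1 - ‖z‖ ^ 2)) ≤
      ENNReal.ofReal (Real.pi * (M - ‖G 0‖ ^ 2)) := by
  rw [lintegral_deriv_sq_weight hG]
  have hfin : ∀ N, ∑ n ∈ Finset.range N, ‖taylorCoeff G n‖ ^ 2 ≤ M := by
    intro N
    have ht : Tendsto (fun r : ℝ => ∑ n ∈ Finset.range N, ‖taylorCoeff G n‖ ^ 2 * r ^ (2 * n))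
        (𝓝[<] 1) (𝓝 (∑ n ∈ Finset.range N, ‖taylorCoeff G n‖ ^ 2 * 1 ^ (2 * n))) :=
      ((by fun_prop : Continuous fun r : ℝ =>
        ∑ n ∈ Finset.range N, ‖taylorCoeff G n‖ ^ 2 * r ^ (2 * n)).tendsto 1).mono_left
        nhdsWithin_le_nhds
    simp only [one_pow, mul_one] at ht
    refine le_of_tendsto ht ?_
    filter_upwards [Ioo_mem_nhdsLT (zero_lt_one' ℝ)] with r hr
    have hS := hasSum_sq_coeff_circleAverage (fun z hz => hasSum_taylorCoeff hG hz) hr.1.le hr.2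
    refine (sum_le_hasSum _ (fun n _ => ?_) hS).trans (hM r hr.1 hr.2)
    have := hr.1
    positivity
  refine ENNReal.tsum_le_of_sum_range_le fun N => ?_
  rw [← ENNReal.ofReal_sum_of_nonneg (fun n _ => by positivity)]
  refine ENNReal.ofReal_le_ofReal ?_
  have h1 := hfin (N + 1)
  rw [Finset.sum_range_succ', taylorCoeff_zero] at h1
  calc ∑ n ∈ Finset.range N, Real.pi * (((n : ℝ) + 1) / (n + 2)) * ‖taylorCoeff G (n + 1)‖ ^ 2
      ≤ ∑ n ∈ Finset.range N, Real.pi * ‖taylorCoeff G (n + 1)‖ ^ 2 := by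
        refine Finset.sum_le_sum fun n _ => ?_
        have : ((n : ℝ) + 1) / (n + 2) ≤ 1 := by
          rw [div_le_one (by positivity)]; linarith
        gcongr
        nlinarith [Real.pi_pos]
    _ = Real.pi * ∑ n ∈ Finset.range N, ‖taylorCoeff G (n + 1)‖ ^ 2 := by rw [Finset.mul_sum]
    _ ≤ _ := by gcongr; linarith

/-- Lower Littlewood–Paley inequality. -/
lemma le_lintegral_deriv_sq_weight {G : ℂ → ℂ} (hG : DifferentiableOn ℂ G disc) {r : ℝ}
    (hr0 : 0 < r) (hr : r < 1) :
    ENNReal.ofReal (Real.pi * (Real.circleAverage (fun z => ‖G z‖ ^ 2) 0 r - ‖G 0‖ ^ 2)) ≤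
      2 * ∫⁻ z in disc, ENNReal.ofReal (‖deriv G z‖ ^ 2 * (1 - ‖z‖ ^ 2)) := by
  rw [lintegral_deriv_sq_weight hG, ← ENNReal.tsum_mul_left]
  have hS := hasSum_sq_coeff_circleAverage (fun z hz => hasSum_taylorCoeff hG hz) hr0.le hr
  have hS' := ((hasSum_nat_add_iff' 1).mpr hS).mul_left Real.pi
  simp only [Finset.range_one, Finset.sum_singleton, mul_zero, pow_zero, mul_one,
    taylorCoeff_zero] at hS'
  rw [← hS'.tsum_eq, ENNReal.ofReal_tsum_of_nonneg (fun n => by positivity) hS'.summable]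
  refine ENNReal.tsum_le_tsum fun n => ?_
  rw [show (2 : ℝ≥0∞) = ENNReal.ofReal 2 by simp, ← ENNReal.ofReal_mul (by norm_num)]
  refine ENNReal.ofReal_le_ofReal ?_
  have h1 : r ^ (2 * (n + 1)) ≤ 1 := pow_le_one₀ hr0.le hr.le
  have h2 : 1 ≤ 2 * (((n : ℝ) + 1) / (n + 2)) := by
    rw [mul_div_assoc', le_div_iff₀ (by positivity)]; linarith
  have h3 : 0 ≤ Real.pi * ‖taylorCoeff G (n + 1)‖ ^ 2 := by positivity
  nlinarith [mul_le_mul_of_nonneg_left h1 h3, mul_le_mul_of_nonneg_left h2 h3]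

/-- The involutive automorphism of the disc exchanging `0` and `w`. -/
def mob (w z : ℂ) : ℂ := (w - z) / (1 - (starRingEnd ℂ) w * z)

lemma one_sub_conj_mul_ne_zero {w z : ℂ} (hw : ‖w‖ < 1) (hz : ‖z‖ ≤ 1) :
    1 - (starRingEnd ℂ) w * z ≠ 0 := by
  intro h
  have h1 : ‖(starRingEnd ℂ) w * z‖ = 1 := by
    rw [← sub_eq_zero.mp h]; simp
  rw [norm_mul, RCLike.norm_conj] at h1
  nlinarith [norm_nonneg w, norm_nonneg z]

lemma norm_one_sub_conj_mul_pos {w z : ℂ} (hw : ‖w‖ ≤ 1) (hz : ‖z‖ < 1) :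
    0 < ‖1 - (starRingEnd ℂ) w * z‖ := by
  have h := norm_sub_norm_le 1 ((starRingEnd ℂ) w * z)
  rw [norm_mul, RCLike.norm_conj, norm_one] at h
  nlinarith [norm_nonneg w, norm_nonneg z]

lemma normSq_one_sub_conj_mul (w z : ℂ) :
    ‖1 - (starRingEnd ℂ) w * z‖ ^ 2 =
      ‖w - z‖ ^ 2 + (1 - ‖w‖ ^ 2) * (1 - ‖z‖ ^ 2) := by
  simp only [← Complex.normSq_eq_norm_sq, Complex.normSq_apply]
  simp
  ring

lemma one_sub_norm_mob_sq {w z : ℂ} (hw : ‖w‖ < 1) (hz : ‖z‖ ≤ 1) :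
    1 - ‖mob w z‖ ^ 2 = (1 - ‖w‖ ^ 2) * (1 - ‖z‖ ^ 2) / ‖1 - (starRingEnd ℂ) w * z‖ ^ 2 := by
  have h := one_sub_conj_mul_ne_zero hw hz
  have h' : ‖1 - (starRingEnd ℂ) w * z‖ ^ 2 ≠ 0 := by positivity
  rw [mob, norm_div, div_pow, eq_div_iff h', sub_mul, one_mul, div_mul_cancel₀ _ h',
    normSq_one_sub_conj_mul]
  ring

lemma norm_mob_lt {w z : ℂ} (hw : ‖w‖ < 1) (hz : ‖z‖ < 1) : ‖mob w z‖ < 1 := by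
  have h := one_sub_norm_mob_sq hw hz.le
  have h1 := norm_one_sub_conj_mul_pos hw.le hz
  have h2 : 0 < 1 - ‖w‖ ^ 2 := by nlinarith [norm_nonneg w]
  have h3 : 0 < 1 - ‖z‖ ^ 2 := by nlinarith [norm_nonneg z]
  have h4 : 0 < (1 - ‖w‖ ^ 2) * (1 - ‖z‖ ^ 2) / ‖1 - (starRingEnd ℂ) w * z‖ ^ 2 := by positivity
  nlinarith [norm_nonneg (mob w z)]

lemma norm_mob_eq_one {w z : ℂ} (hw : ‖w‖ < 1) (hz : ‖z‖ = 1) : ‖mob w z‖ = 1 := by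
  have h := one_sub_norm_mob_sq hw hz.le
  rw [hz] at h
  simp at h
  nlinarith [norm_nonneg (mob w z)]

lemma norm_mob_le {w z : ℂ} (hw : ‖w‖ < 1) (hz : ‖z‖ ≤ 1) : ‖mob w z‖ ≤ 1 := by
  rcases hz.lt_or_eq with h | h
  · exact (norm_mob_lt hw h).le
  · exact (norm_mob_eq_one hw h).le

lemma mem_disc {z : ℂ} : z ∈ disc ↔ ‖z‖ < 1 := by simp [disc]

lemma mob_mem_disc {w z : ℂ} (hw : w ∈ disc) (hz : z ∈ disc) : mob w z ∈ disc :=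
  mem_disc.mpr (norm_mob_lt (mem_disc.mp hw) (mem_disc.mp hz))

lemma mob_zero (w : ℂ) : mob w 0 = w := by simp [mob]

lemma one_sub_conj_mul_self_ne_zero {w : ℂ} (hw : ‖w‖ < 1) : 1 - (starRingEnd ℂ) w * w ≠ 0 :=
  one_sub_conj_mul_ne_zero hw hw.le

lemma one_sub_conj_mul_mob {w z : ℂ} (hw : ‖w‖ < 1) (hz : ‖z‖ ≤ 1) :
    1 - (starRingEnd ℂ) w * mob w z =
      (1 - (starRingEnd ℂ) w * w) / (1 - (starRingEnd ℂ) w * z) := by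
  have h := one_sub_conj_mul_ne_zero hw hz
  rw [mob]
  field_simp
  ring

lemma mob_mob {w z : ℂ} (hw : ‖w‖ < 1) (hz : ‖z‖ ≤ 1) : mob w (mob w z) = z := by
  have h := one_sub_conj_mul_ne_zero hw hz
  have h0 := one_sub_conj_mul_self_ne_zero hw
  conv_lhs => rw [mob, one_sub_conj_mul_mob hw hz]
  rw [div_div_eq_mul_div, div_eq_iff h0, mob, sub_mul, div_mul_cancel₀ _ h]
  ring

lemma hasDerivAt_mob {w z : ℂ} (hw : ‖w‖ < 1) (hz : ‖z‖ ≤ 1) :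
    HasDerivAt (mob w) (-(1 - (starRingEnd ℂ) w * w) / (1 - (starRingEnd ℂ) w * z) ^ 2) z := by
  have h := one_sub_conj_mul_ne_zero hw hz
  have h1 : HasDerivAt (fun z : ℂ => w - z) (-1) z := by
    simpa using (hasDerivAt_id z).const_sub w
  have h2 : HasDerivAt (fun z : ℂ => 1 - (starRingEnd ℂ) w * z) (-(starRingEnd ℂ) w) z := by
    simpa using ((hasDerivAt_id z).const_mul ((starRingEnd ℂ) w)).const_sub 1
  refine (h1.div h2 h).congr_deriv ?_
  congr 1
  ring

lemma differentiableOn_mob {w : ℂ} (hw : w ∈ disc) : DifferentiableOn ℂ (mob w) disc :=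
  fun _ hz => (hasDerivAt_mob (mem_disc.mp hw)
    (mem_disc.mp hz).le).differentiableAt.differentiableWithinAt

lemma mapsTo_mob {w : ℂ} (hw : w ∈ disc) : MapsTo (mob w) disc disc :=
  fun _ hz => mob_mem_disc hw hz

lemma mob_image_disc {w : ℂ} (hw : w ∈ disc) : mob w '' disc = disc := by
  refine Subset.antisymm (mapsTo_mob hw).image_subset fun z hz => ?_
  exact ⟨mob w z, mob_mem_disc hw hz, mob_mob (mem_disc.mp hw) (mem_disc.mp hz).le⟩

lemma injOn_mob {w : ℂ} (hw : w ∈ disc) : InjOn (mob w) disc := by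
  intro x hx y hy h
  rw [← mob_mob (mem_disc.mp hw) (mem_disc.mp hx).le, h,
    mob_mob (mem_disc.mp hw) (mem_disc.mp hy).le]

lemma abs_det_restrictScalars_toSpanSingleton (c : ℂ) :
    |((ContinuousLinearMap.toSpanSingleton ℂ c).restrictScalars ℝ).det| = ‖c‖ ^ 2 := by
  rw [← Complex.normSq_eq_norm_sq]
  have : ((ContinuousLinearMap.toSpanSingleton ℂ c).restrictScalars ℝ).det = Complex.normSq c := by
    rw [ContinuousLinearMap.det, ← LinearMap.det_toMatrix Complex.basisOneI, Matrix.det_fin_two]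
    simp [LinearMap.toMatrix_apply, Complex.normSq_apply]
  rw [this, abs_of_nonneg (Complex.normSq_nonneg _)]

/-- The local Dirichlet-type integral with kernel `(1 - |z|²) / |1 - w̄ z|²`. -/
def dirA (F : ℂ → ℂ) (w : ℂ) : ℝ≥0∞ :=
  ∫⁻ z in disc, ENNReal.ofReal
    (‖deriv F z‖ ^ 2 * ((1 - ‖z‖ ^ 2) / ‖1 - (starRingEnd ℂ) w * z‖ ^ 2))

lemma dirA_zero (F : ℂ → ℂ) :
    dirA F 0 = ∫⁻ z in disc, ENNReal.ofReal (‖deriv F z‖ ^ 2 * (1 - ‖z‖ ^ 2)) := by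
  simp [dirA]

lemma dirA_comp_mob {F : ℂ → ℂ} (hF : DifferentiableOn ℂ F disc) {w : ℂ} (hw : w ∈ disc) :
    dirA (F ∘ mob w) 0 = ENNReal.ofReal (1 - ‖w‖ ^ 2) * dirA F w := by
  have hw' := mem_disc.mp hw
  have hpos : 0 ≤ 1 - ‖w‖ ^ 2 := by nlinarith [norm_nonneg w]
  have key := lintegral_image_eq_lintegral_abs_det_fderiv_mul volume measurableSet_disc
    (f := mob w) (f' := fun z => (ContinuousLinearMap.toSpanSingleton ℂ
      (-(1 - (starRingEnd ℂ) w * w) / (1 - (starRingEnd ℂ) w * z) ^ 2)).restrictScalars ℝ)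
    (fun z hz => ((hasDerivAt_mob hw' (mem_disc.mp hz).le).hasFDerivAt.restrictScalars
      ℝ).hasFDerivWithinAt) (injOn_mob hw)
    (fun u => ENNReal.ofReal (‖deriv F u‖ ^ 2 * (1 - ‖mob w u‖ ^ 2)))
  rw [mob_image_disc hw] at key
  rw [dirA_zero, dirA, ← lintegral_const_mul' _ _ ENNReal.ofReal_ne_top]
  trans ∫⁻ u in disc, ENNReal.ofReal (‖deriv F u‖ ^ 2 * (1 - ‖mob w u‖ ^ 2))
  · rw [key]
    refine setLIntegral_congr_fun measurableSet_disc fun z hz => ?_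
    have hz' := mem_disc.mp hz
    have hd : deriv (F ∘ mob w) z = deriv F (mob w z) *
        (-(1 - (starRingEnd ℂ) w * w) / (1 - (starRingEnd ℂ) w * z) ^ 2) :=
      ((hF.differentiableAt (Metric.isOpen_ball.mem_nhds (mob_mem_disc hw hz))).hasDerivAt.comp z
        (hasDerivAt_mob hw' hz'.le)).deriv
    rw [abs_det_restrictScalars_toSpanSingleton, mob_mob hw' hz'.le, hd,
      ← ENNReal.ofReal_mul (by positivity), norm_mul]
    ring_nf
  · refine setLIntegral_congr_fun measurableSet_disc fun z hz => ?_
    rw [← ENNReal.ofReal_mul hpos, one_sub_norm_mob_sq hw' (mem_disc.mp hz).le]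
    ring_nf

lemma bpt_eq_circleMap (t : ℝ) : bpt t = circleMap 0 1 t := by
  simp [bpt, circleMap, mul_comm]

@[simp] lemma norm_bpt (t : ℝ) : ‖bpt t‖ = 1 := by simp [bpt_eq_circleMap]

@[fun_prop] lemma continuous_bpt : Continuous bpt := by unfold bpt; fun_prop

lemma norm_bpt_sub_pos {w : ℂ} (hw : w ∈ disc) (t : ℝ) : 0 < ‖bpt t - w‖ := by
  have := norm_sub_norm_le (bpt t) w
  rw [norm_bpt] at this
  linarith [mem_disc.mp hw]

lemma bpt_sub_ne_zero {w : ℂ} (hw : w ∈ disc) (t : ℝ) : bpt t - w ≠ 0 :=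
  norm_pos_iff.mp (norm_bpt_sub_pos hw t)

/-- The Poisson kernel at `bpt t`. -/
def pk (w : ℂ) (t : ℝ) : ℝ := (1 - ‖w‖ ^ 2) / ‖bpt t - w‖ ^ 2

lemma continuous_pk {w : ℂ} (hw : w ∈ disc) : Continuous (pk w) := by
  unfold pk
  exact Continuous.div (by fun_prop) (by fun_prop) fun t => by
    have := norm_bpt_sub_pos hw t; positivity

lemma one_sub_normSq_pos {w : ℂ} (hw : w ∈ disc) : 0 < 1 - ‖w‖ ^ 2 := by
  have := mem_disc.mp hw
  nlinarith [norm_nonneg w]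

lemma pk_nonneg {w : ℂ} (hw : w ∈ disc) (t : ℝ) : 0 ≤ pk w t :=
  div_nonneg (one_sub_normSq_pos hw).le (by positivity)

lemma poissonExt_eq (u : ℝ → ℝ) (w : ℂ) :
    poissonExt u w = (1 / (2 * Real.pi)) * ∫ t in (0:ℝ)..(2 * Real.pi), pk w t * u t := rfl

/-- Integrability over a period. -/
abbrev Per (u : ℝ → ℝ) : Prop := IntervalIntegrable u volume 0 (2 * Real.pi)

lemma per_pk_mul {w : ℂ} (hw : w ∈ disc) {u : ℝ → ℝ} (hu : Per u) : Per fun t => pk w t * u t :=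
  hu.continuousOn_mul (continuous_pk hw).continuousOn

lemma per_iff {u : ℝ → ℝ} : Per u ↔ Integrable u θm := by
  rw [Per, intervalIntegrable_iff_integrableOn_Ioc_of_le (by positivity)]; rfl

/-- Extend a function on `(0, 2π]` to the circle. -/
def circLift (u : ℝ → ℝ) (ζ : ℂ) : ℝ := u (toIocMod Real.two_pi_pos 0 (arg ζ))

lemma circLift_circleMap (u : ℝ → ℝ) {t : ℝ} (ht : t ∈ Ioc 0 (2 * Real.pi)) :
    circLift u (circleMap 0 1 t) = u t := by
  have h : arg (circleMap 0 1 t) = toIocMod Real.two_pi_pos (-Real.pi) t := by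
    simp only [circleMap, zero_add, ofReal_one, one_mul]
    exact Complex.arg_exp_mul_I t
  rw [circLift, h, toIocMod.eq_def _ (-Real.pi), toIocMod_sub_zsmul, (toIocMod_eq_self _).mpr (by simpa using ht)]

lemma intervalIntegral_congr_Ioc {E : Type*} [NormedAddCommGroup E] [NormedSpace ℝ E]
    {F G : ℝ → E} (h : ∀ t ∈ Ioc 0 (2 * Real.pi), F t = G t) :
    ∫ t in (0:ℝ)..(2 * Real.pi), F t = ∫ t in (0:ℝ)..(2 * Real.pi), G t := by
  rw [intervalIntegral.integral_of_le (by positivity),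
    intervalIntegral.integral_of_le (by positivity)]
  exact setIntegral_congr_fun measurableSet_Ioc h

lemma circleIntegrable_circLift {u : ℝ → ℝ} (hu : Per u) : CircleIntegrable (circLift u) 0 1 := by
  unfold CircleIntegrable
  refine hu.congr fun t ht => ?_
  rw [uIoc_of_le (by positivity)] at ht
  exact (circLift_circleMap u ht).symm

lemma circleIntegrable_ofReal_circLift {u : ℝ → ℝ} (hu : Per u) :
    CircleIntegrable (fun ζ => (circLift u ζ : ℂ)) 0 1 := by
  have := circleIntegrable_circLift hu
  unfold CircleIntegrable at this ⊢
  rw [intervalIntegrable_iff] at this ⊢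
  exact this.ofReal

/-- The Herglotz integral. -/
def herg (u : ℝ → ℝ) (z : ℂ) : ℂ :=
  ((2 * Real.pi : ℝ) : ℂ)⁻¹ *
    ∫ t in (0:ℝ)..(2 * Real.pi), ((bpt t + z) / (bpt t - z)) * (u t : ℂ)

lemma herg_eq_circleAverage (u : ℝ → ℝ) (z : ℂ) :
    herg u z = Real.circleAverage (fun ζ => herglotzRieszKernel 0 z ζ • (circLift u ζ : ℂ)) 0 1 := by
  rw [herg, Real.circleAverage, Complex.real_smul, Complex.ofReal_inv]
  congr 1
  refine intervalIntegral_congr_Ioc fun t ht => ?_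
  rw [circLift_circleMap u ht, herglotzRieszKernel_def, bpt_eq_circleMap]
  simp

lemma differentiableOn_herg {u : ℝ → ℝ} (hu : Per u) : DifferentiableOn ℂ (herg u) disc := by
  have := differentiableOn_circleAverage_herglotzRieszKernel_smul
    (circleIntegrable_ofReal_circLift hu)
  exact this.congr fun z _ => herg_eq_circleAverage u z

lemma re_herg {u : ℝ → ℝ} (hu : Per u) {z : ℂ} (hz : z ∈ disc) :
    (herg u z).re = poissonExt u z := by
  rw [herg_eq_circleAverage, re_circleAverage_herglotzRieszKernel_smul
    (circleIntegrable_circLift hu) hz, poissonExt, Real.circleAverage, smul_eq_mul, one_div]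
  congr 1
  refine intervalIntegral_congr_Ioc fun t ht => ?_
  simp only [Pi.smul_apply', smul_eq_mul]
  rw [circLift_circleMap u ht, ← poissonKernel_eq_re_herglotzRieszKernel, poissonKernel_def,
    bpt_eq_circleMap]
  simp

lemma poissonExt_const (c : ℝ) {w : ℂ} (hw : w ∈ disc) : poissonExt (fun _ => c) w = c := by
  have h := DiffContOnCl.circleAverage_poissonKernel_smul' (c := 0) (R := 1)
    (f := fun _ : ℂ => (c : ℂ)) diffContOnCl_const hw
  have h2 : ((poissonExt (fun _ => c) w : ℝ) : ℂ) = c := by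
    rw [← h, Real.circleAverage, poissonExt, Complex.real_smul]
    push_cast
    rw [one_div, mul_inv]
    congr 1
    rw [← intervalIntegral.integral_ofReal]
    refine intervalIntegral.integral_congr fun t _ => ?_
    simp [bpt_eq_circleMap]
  exact_mod_cast h2

lemma poissonExt_add {u v : ℝ → ℝ} (hu : Per u) (hv : Per v) {w : ℂ} (hw : w ∈ disc) :
    poissonExt (fun t => u t + v t) w = poissonExt u w + poissonExt v w := by
  simp only [poissonExt_eq, mul_add]
  rw [intervalIntegral.integral_add (per_pk_mul hw hu) (per_pk_mul hw hv), mul_add]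

lemma poissonExt_sub {u v : ℝ → ℝ} (hu : Per u) (hv : Per v) {w : ℂ} (hw : w ∈ disc) :
    poissonExt (fun t => u t - v t) w = poissonExt u w - poissonExt v w := by
  simp only [poissonExt_eq, mul_sub]
  rw [intervalIntegral.integral_sub (per_pk_mul hw hu) (per_pk_mul hw hv), mul_sub]

lemma poissonExt_const_mul (c : ℝ) (u : ℝ → ℝ) (w : ℂ) :
    poissonExt (fun t => c * u t) w = c * poissonExt u w := by
  simp only [poissonExt_eq]
  simp_rw [mul_left_comm _ c]
  rw [intervalIntegral.integral_const_mul]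
  ring

lemma poissonExt_mono {u v : ℝ → ℝ} (hu : Per u) (hv : Per v) (h : ∀ᵐ t ∂θm, u t ≤ v t)
    {w : ℂ} (hw : w ∈ disc) : poissonExt u w ≤ poissonExt v w := by
  simp only [poissonExt_eq]
  refine mul_le_mul_of_nonneg_left ?_ (by positivity)
  refine intervalIntegral.integral_mono_ae_restrict (by positivity) (per_pk_mul hw hu)
    (per_pk_mul hw hv) ?_
  rw [← Measure.restrict_congr_set Ioc_ae_eq_Icc]
  filter_upwards [h] with t ht
  exact mul_le_mul_of_nonneg_left ht (pk_nonneg hw t)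

lemma herg_congr {u v : ℝ → ℝ} (h : ∀ᵐ t ∂θm, u t = v t) (w : ℂ) : herg u w = herg v w := by
  simp only [herg]
  congr 1
  rw [intervalIntegral.integral_of_le (by positivity),
    intervalIntegral.integral_of_le (by positivity)]
  refine integral_congr_ae ?_
  filter_upwards [h] with t ht
  rw [ht]

lemma herg_add {u v : ℝ → ℝ} (hu : Per u) (hv : Per v) {w : ℂ} (hw : w ∈ disc) :
    herg (fun t => u t + v t) w = herg u w + herg v w := by
  have hk : Continuous fun t => (bpt t + w) / (bpt t - w) :=
    Continuous.div (by fun_prop) (by fun_prop) (bpt_sub_ne_zero hw)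
  have hc : ∀ {u : ℝ → ℝ}, Per u → IntervalIntegrable
      (fun t => ((bpt t + w) / (bpt t - w)) * (u t : ℂ)) volume 0 (2 * Real.pi) := by
    intro u hu
    refine IntervalIntegrable.continuousOn_mul ?_ hk.continuousOn
    rw [Per, intervalIntegrable_iff] at hu
    rw [intervalIntegrable_iff]
    exact hu.ofReal
  simp only [herg, ofReal_add, mul_add]
  rw [intervalIntegral.integral_add (hc hu) (hc hv), mul_add]

lemma norm_exp_herg {u : ℝ → ℝ} (hu : Per u) {z : ℂ} (hz : z ∈ disc) :
    ‖Complex.exp (herg u z)‖ = Real.exp (poissonExt u z) := by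
  rw [Complex.norm_exp, re_herg hu hz]

lemma hasDerivAt_bpt (t : ℝ) : HasDerivAt bpt (Complex.I * bpt t) t := by
  have h : HasDerivAt (fun t : ℝ => Complex.I * (t : ℂ)) Complex.I t := by
    simpa using (Complex.ofRealCLM.hasDerivAt (x := t)).const_mul Complex.I
  exact h.cexp.congr_deriv (by rw [bpt, mul_comm])

lemma exists_bpt_eq {z : ℂ} (hz : ‖z‖ = 1) : ∃ s, z = bpt s :=
  ⟨arg z, by rw [bpt, mul_comm]; simpa [hz] using (Complex.norm_mul_exp_arg_mul_I z).symm⟩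

lemma bpt_add (s t : ℝ) : bpt (s + t) = bpt s * bpt t := by
  simp [bpt, mul_add, Complex.exp_add]

lemma bpt_mul_bpt_neg (t : ℝ) : bpt t * bpt (-t) = 1 := by
  rw [← bpt_add]; simp [bpt]

lemma conj_bpt (t : ℝ) : (starRingEnd ℂ) (bpt t) = bpt (-t) := by
  rw [bpt, bpt, ← Complex.exp_conj]; simp

lemma pk_eq {w : ℂ} (hw : w ∈ disc) (t : ℝ) : (pk w t : ℂ) =
    (1 - (starRingEnd ℂ) w * w) * bpt t / ((1 - (starRingEnd ℂ) w * bpt t) * (bpt t - w)) := by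
  have h1 := bpt_sub_ne_zero hw t
  have h2 := one_sub_conj_mul_ne_zero (mem_disc.mp hw) (norm_bpt t).le
  have h3 : ((‖bpt t - w‖ : ℂ)) ^ 2 = (1 - (starRingEnd ℂ) w * bpt t) * (bpt t - w) * bpt (-t) := by
    rw [← Complex.mul_conj', map_sub, conj_bpt]
    linear_combination ((bpt t - w) * (starRingEnd ℂ) w) * bpt_mul_bpt_neg t
  have h5 : bpt (-t) ≠ 0 := by rw [← norm_pos_iff]; simp
  have h6 : (1 - (‖w‖ : ℂ) ^ 2) = 1 - (starRingEnd ℂ) w * w := by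
    rw [← Complex.mul_conj']; ring
  rw [pk]
  push_cast
  rw [h3, h6, div_eq_div_iff (by simp [h1, h2, h5]) (by simp [h1, h2])]
  linear_combination (-(1 - (starRingEnd ℂ) w * w) * (1 - (starRingEnd ℂ) w * bpt t) *
    (bpt t - w)) * bpt_mul_bpt_neg t

lemma circleAverage_eq_of_mob {H : ℂ → ℝ} (hH : ContinuousOn H circleT) {w : ℂ} (hw : w ∈ disc) :
    poissonExt (fun t => H (mob w (bpt t))) w = Real.circleAverage H 0 1 := by
  have hw' := mem_disc.mp hw
  set θ : ℝ → ℝ := fun t => ∫ s in (0 : ℝ)..t, pk w s with hθ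
  have hd : ∀ t, HasDerivAt θ (pk w t) t := fun t =>
    intervalIntegral.integral_hasDerivAt_right ((continuous_pk hw).intervalIntegrable _ _)
      (continuous_pk hw).stronglyMeasurable.stronglyMeasurableAtFilter
      (continuous_pk hw).continuousAt
  have h2π : θ (2 * Real.pi) = 2 * Real.pi := by
    have := poissonExt_const 1 hw
    simp only [poissonExt_eq, mul_one] at this
    field_simp at this
    exact this
  have hder : ∀ t, HasDerivAt (fun t => mob w (bpt t) * bpt (-θ t)) 0 t := by
    intro t
    have e1 := (hasDerivAt_mob hw' (norm_bpt t).le).comp t (hasDerivAt_bpt t)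
    have e2 := (hasDerivAt_bpt (-θ t)).scomp t (hd t).neg
    refine (e1.mul e2).congr_deriv ?_
    have h1 := bpt_sub_ne_zero hw t
    have h2 := one_sub_conj_mul_ne_zero hw' (norm_bpt t).le
    simp only [Function.comp_apply, Complex.real_smul, ofReal_neg, Pi.neg_apply, pk_eq hw, mob]
    field_simp
    ring
  have hconst : ∀ t, mob w (bpt t) * bpt (-θ t) = mob w (bpt 0) * bpt (-θ 0) := fun t =>
    is_const_of_deriv_eq_zero (fun t => (hder t).differentiableAt) (fun t => (hder t).deriv) t 0
  obtain ⟨s₀, hs₀⟩ := exists_bpt_eq (norm_mob_eq_one hw' (norm_bpt 0))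
  have hθ0 : θ 0 = 0 := by simp [hθ]
  have hm : ∀ t, mob w (bpt t) = bpt (s₀ + θ t) := by
    intro t
    have h := hconst t
    rw [hθ0, hs₀] at h
    rw [bpt_add, ← mul_one (mob w (bpt t)), ← bpt_mul_bpt_neg (θ t)]
    have h0 : bpt (-0) = 1 := by simp [bpt]
    rw [h0] at h
    linear_combination bpt (θ t) * h
  have hHc : Continuous (H ∘ bpt) :=
    hH.comp_continuous continuous_bpt fun t => by simp [circleT]
  have hsub := intervalIntegral.integral_comp_mul_deriv (a := 0) (b := 2 * Real.pi)
    (f := fun t => s₀ + θ t) (f' := pk w) (g := H ∘ bpt)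
    (fun t _ => (hd t).const_add s₀) (continuous_pk hw).continuousOn hHc
  rw [hθ0, h2π] at hsub
  rw [Real.circleAverage_eq_integral_add s₀, poissonExt_eq, smul_eq_mul, one_div,
    intervalIntegral.integral_comp_add_right (fun θ => H (circleMap 0 1 θ))]
  congr 1
  have e3 : ∀ t, pk w t * H (mob w (bpt t)) = ((H ∘ bpt) ∘ fun t => s₀ + θ t) t * pk w t := by
    intro t
    simp [hm, mul_comm]
  simp_rw [e3, hsub, Function.comp_def, bpt_eq_circleMap]
  congr 1 <;> ring

/-- Circle change of variables for Möbius maps. -/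
lemma circleAverage_comp_mob {H : ℂ → ℝ} (hH : ContinuousOn H circleT) {w : ℂ} (hw : w ∈ disc) :
    Real.circleAverage (H ∘ mob w) 0 1 = poissonExt (fun t => H (bpt t)) w := by
  have hw' := mem_disc.mp hw
  have hc : ContinuousOn (H ∘ mob w) circleT := by
    refine hH.comp (fun z hz => ?_) fun z hz => ?_
    · have hz' : ‖z‖ = 1 := by simpa [circleT] using hz
      exact (hasDerivAt_mob hw' hz'.le).continuousAt.continuousWithinAt
    · have hz' : ‖z‖ = 1 := by simpa [circleT] using hz
      simpa [circleT] using norm_mob_eq_one hw' hz'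
  rw [← circleAverage_eq_of_mob hc hw]
  congr 1
  ext t
  simp [mob_mob hw' (norm_bpt t).le]

lemma bregman_nonneg (x c : ℝ) :
    0 ≤ Real.exp (2 * x) - Real.exp (2 * c) - 2 * Real.exp (2 * c) * (x - c) := by
  have h := Real.add_one_le_exp (2 * (x - c))
  have h2 : Real.exp (2 * x) = Real.exp (2 * c) * Real.exp (2 * (x - c)) := by
    rw [← Real.exp_add]; ring_nf
  rw [h2]
  nlinarith [Real.exp_pos (2 * c)]

lemma per_exp_two_mul {u : ℝ → ℝ} (hu : Per u) {M : ℝ} (hM : ∀ᵐ t ∂θm, u t ≤ M) :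
    Per fun t => Real.exp (2 * u t) := by
  rw [per_iff] at hu ⊢
  have : IsFiniteMeasure θm := by unfold θm; infer_instance
  refine Integrable.of_bound (C := Real.exp (2 * M)) ?_ ?_
  · exact Real.continuous_exp.comp_aestronglyMeasurable (hu.aestronglyMeasurable.const_mul 2)
  · filter_upwards [hM] with t ht
    rw [Real.norm_of_nonneg (Real.exp_pos _).le]
    exact Real.exp_le_exp.mpr (by linarith)

lemma per_const (c : ℝ) : Per fun _ => c := intervalIntegrable_const

lemma poissonExt_bregman {u : ℝ → ℝ} (hu : Per u) (he : Per fun t => Real.exp (2 * u t))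
    (c : ℝ) {w : ℂ} (hw : w ∈ disc) :
    poissonExt (fun t => Real.exp (2 * u t) - Real.exp (2 * c) -
      2 * Real.exp (2 * c) * (u t - c)) w = poissonExt (fun t => Real.exp (2 * u t)) w -
      Real.exp (2 * c) - 2 * Real.exp (2 * c) * (poissonExt u w - c) := by
  rw [poissonExt_sub (he.sub (per_const _)) ((hu.sub (per_const c)).const_mul _) hw,
    poissonExt_sub he (per_const _) hw, poissonExt_const_mul, poissonExt_sub hu (per_const _) hw,
    poissonExt_const _ hw, poissonExt_const _ hw]

lemma poissonExt_nonneg {u : ℝ → ℝ} (h : ∀ t, 0 ≤ u t) {w : ℂ} (hw : w ∈ disc) :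
    0 ≤ poissonExt u w := by
  rw [poissonExt_eq]
  exact mul_nonneg (by positivity) (intervalIntegral.integral_nonneg (by positivity)
    fun t _ => mul_nonneg (pk_nonneg hw t) (h t))

lemma exp_two_mul_poissonExt_le {u : ℝ → ℝ} (hu : Per u) (he : Per fun t => Real.exp (2 * u t))
    {w : ℂ} (hw : w ∈ disc) :
    Real.exp (2 * poissonExt u w) ≤ poissonExt (fun t => Real.exp (2 * u t)) w := by
  have h := poissonExt_bregman hu he (poissonExt u w) hw
  have h2 := poissonExt_nonneg (fun t => bregman_nonneg (u t) (poissonExt u w)) hw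
  rw [h, sub_self, mul_zero, sub_zero] at h2
  linarith

lemma norm_exp_herg_sq {u : ℝ → ℝ} (hu : Per u) {z : ℂ} (hz : z ∈ disc) :
    ‖Complex.exp (herg u z)‖ ^ 2 = Real.exp (2 * poissonExt u z) := by
  rw [norm_exp_herg hu hz, ← Real.exp_nat_mul]; norm_num

/-- The outer function with log-modulus `u` has local Dirichlet integral controlled by the
Jensen gap. -/
lemma dirA_exp_herg_le {u : ℝ → ℝ} (hu : Per u) (he : Per fun t => Real.exp (2 * u t))
    {w : ℂ} (hw : w ∈ disc) :
    ENNReal.ofReal (1 - ‖w‖ ^ 2) * dirA (fun z => Complex.exp (herg u z)) w ≤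
      ENNReal.ofReal (Real.pi * (poissonExt (fun t => Real.exp (2 * u t)) w -
        Real.exp (2 * poissonExt u w))) := by
  have hg : DifferentiableOn ℂ (fun z => Complex.exp (herg u z)) disc :=
    (differentiableOn_herg hu).cexp
  have hG : DifferentiableOn ℂ ((fun z => Complex.exp (herg u z)) ∘ mob w) disc :=
    hg.comp (differentiableOn_mob hw) (mapsTo_mob hw)
  have hH : DifferentiableOn ℂ (herg (fun t => Real.exp (2 * u t)) ∘ mob w) disc :=
    (differentiableOn_herg he).comp (differentiableOn_mob hw) (mapsTo_mob hw)
  rw [← dirA_comp_mob hg hw, dirA_zero]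
  refine (lintegral_deriv_sq_weight_le hG
    (M := poissonExt (fun t => Real.exp (2 * u t)) w) fun r hr0 hr1 => ?_).trans_eq ?_
  · have hsub : closedBall (0 : ℂ) |r| ⊆ disc := by
      rw [abs_of_pos hr0]; exact closedBall_subset_ball hr1
    have hsub' : sphere (0 : ℂ) |r| ⊆ disc := sphere_subset_closedBall.trans hsub
    have hHc : CircleIntegrable (herg (fun t => Real.exp (2 * u t)) ∘ mob w) 0 r :=
      (hH.continuousOn.mono hsub').circleIntegrable'
    have h1 : Real.circleAverage (Complex.reCLM ∘ (herg (fun t => Real.exp (2 * u t)) ∘ mob w)) 0 r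
        = poissonExt (fun t => Real.exp (2 * u t)) w := by
      rw [ContinuousLinearMap.circleAverage_comp_comm _ hHc,
        DiffContOnCl.circleAverage ((hH.mono hsub).diffContOnCl_ball subset_rfl)]
      simp only [Function.comp_apply, mob_zero, Complex.reCLM_apply]
      exact re_herg he hw
    rw [← h1]
    refine Real.circleAverage_mono ?_ ?_ fun z hz => ?_
    · exact ContinuousOn.circleIntegrable' ((hG.continuousOn.mono hsub').norm.pow 2)
    · exact ContinuousOn.circleIntegrable'
        (Complex.reCLM.continuous.comp_continuousOn (hH.continuousOn.mono hsub'))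
    · have hz' := mob_mem_disc hw (hsub' hz)
      simp only [Function.comp_apply, Complex.reCLM_apply]
      rw [norm_exp_herg_sq hu hz', re_herg he hz']
      exact exp_two_mul_poissonExt_le hu he hz'
  · simp only [Function.comp_apply, mob_zero]
    rw [norm_exp_herg_sq hu hw]

lemma poissonExt_sub_le_dirA {F : ℂ → ℂ} (hF : DifferentiableOn ℂ F disc)
    (hFc : ContinuousOn F (closedBall 0 1)) {w : ℂ} (hw : w ∈ disc) :
    ENNReal.ofReal (Real.pi * (poissonExt (fun t => ‖F (bpt t)‖ ^ 2) w - ‖F w‖ ^ 2)) ≤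
      2 * (ENNReal.ofReal (1 - ‖w‖ ^ 2) * dirA F w) := by
  have hw' := mem_disc.mp hw
  have hG : DifferentiableOn ℂ (F ∘ mob w) disc :=
    hF.comp (differentiableOn_mob hw) (mapsTo_mob hw)
  have hmc : ContinuousOn (mob w) (closedBall 0 1) := fun z hz =>
    (hasDerivAt_mob hw' (by simpa using hz)).continuousAt.continuousWithinAt
  have hGc : ContinuousOn (F ∘ mob w) (closedBall 0 1) :=
    hFc.comp hmc fun z hz => by simpa using norm_mob_le hw' (by simpa using hz)
  have hcirc : Real.circleAverage (fun z => ‖(F ∘ mob w) z‖ ^ 2) 0 1 =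
      poissonExt (fun t => ‖F (bpt t)‖ ^ 2) w :=
    circleAverage_comp_mob (H := fun z => ‖F z‖ ^ 2)
      ((hFc.mono sphere_subset_closedBall).norm.pow 2) hw
  have hcont : ContinuousOn (Real.circleAverage (fun z => ‖(F ∘ mob w) z‖ ^ 2) 0) (Icc 0 1) := by
    refine Real.ContinuousOn.circleAverage ((hGc.norm.pow 2).mono fun z hz => ?_) fun r hr => hr.1
    simpa using hz
  have ht : Tendsto (Real.circleAverage (fun z => ‖(F ∘ mob w) z‖ ^ 2) 0) (𝓝[<] 1)
      (𝓝 (poissonExt (fun t => ‖F (bpt t)‖ ^ 2) w)) := by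
    rw [← hcirc, ← nhdsWithin_Ioo_eq_nhdsLT (zero_lt_one' ℝ)]
    exact ((hcont 1 (by simp)).mono Ioo_subset_Icc_self).tendsto
  rw [← dirA_comp_mob hF hw, dirA_zero]
  have ht2 := ENNReal.tendsto_ofReal ((ht.sub_const (‖F w‖ ^ 2)).const_mul Real.pi)
  refine le_of_tendsto ht2 ?_
  filter_upwards [Ioo_mem_nhdsLT (zero_lt_one' ℝ)] with r hr
  have := le_lintegral_deriv_sq_weight hG hr.1 hr.2
  simpa only [Function.comp_apply, mob_zero] using this

lemma dirA_dilation_le {F : ℂ → ℂ} (hF : DifferentiableOn ℂ F disc) {w : ℂ} (hw : w ∈ disc)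
    {r : ℝ} (hr0 : 0 < r) (hr1 : r < 1) (hwr : ‖w‖ ≤ r) :
    dirA (fun z => F (r * z)) w ≤ 4 * dirA F w := by
  have hw' := mem_disc.mp hw
  have hmem : ∀ z ∈ disc, (r : ℂ) * z ∈ disc := by
    intro z hz
    rw [mem_disc] at hz ⊢
    rw [norm_mul, Complex.norm_real, Real.norm_of_nonneg hr0.le]
    nlinarith [norm_nonneg z]
  have hd : ∀ z, HasDerivAt (fun z : ℂ => (r : ℂ) * z) (r : ℂ) z := fun z => by
    simpa using (hasDerivAt_id z).const_mul (r : ℂ)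
  have key := lintegral_image_eq_lintegral_abs_det_fderiv_mul volume measurableSet_disc
    (f := fun z : ℂ => (r : ℂ) * z)
    (f' := fun _ => (ContinuousLinearMap.toSpanSingleton ℂ (r : ℂ)).restrictScalars ℝ)
    (fun z _ => ((hd z).hasFDerivAt.restrictScalars ℝ).hasFDerivWithinAt)
    (fun x _ y _ h => mul_left_cancel₀ (by exact_mod_cast hr0.ne') h)
    (fun u => ENNReal.ofReal
      (‖deriv F u‖ ^ 2 * ((1 - ‖u‖ ^ 2) / ‖1 - (starRingEnd ℂ) w * u‖ ^ 2)))
  have hle : ∫⁻ u in (fun z : ℂ => (r : ℂ) * z) '' disc, ENNReal.ofReal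
      (‖deriv F u‖ ^ 2 * ((1 - ‖u‖ ^ 2) / ‖1 - (starRingEnd ℂ) w * u‖ ^ 2)) ≤ dirA F w :=
    lintegral_mono_set (by rintro _ ⟨z, hz, rfl⟩; exact hmem z hz)
  rw [key] at hle
  refine le_trans ?_ (mul_le_mul_right hle 4)
  rw [← lintegral_const_mul' _ _ (by simp), dirA]
  refine setLIntegral_mono' measurableSet_disc fun z hz => ?_
  have hz' := mem_disc.mp hz
  have hdz : deriv (fun z => F (r * z)) z = deriv F (r * z) * r :=
    ((hF.differentiableAt (Metric.isOpen_ball.mem_nhds (hmem z hz))).hasDerivAt.comp z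
        (hd z)).deriv
  rw [abs_det_restrictScalars_toSpanSingleton, hdz,
    ← ENNReal.ofReal_mul (by positivity), show (4 : ℝ≥0∞) = ENNReal.ofReal 4 by simp,
    ← ENNReal.ofReal_mul (by positivity), norm_mul, mul_pow]
  refine ENNReal.ofReal_le_ofReal ?_
  have hrn : ‖(r : ℂ)‖ = r := by rw [Complex.norm_real, Real.norm_of_nonneg hr0.le]
  have hp1 := norm_one_sub_conj_mul_pos hw'.le hz'
  have hp2 := norm_one_sub_conj_mul_pos hw'.le (mem_disc.mp (hmem z hz))
  have h1 : ‖1 - (starRingEnd ℂ) w * (r * z)‖ ≤ 2 * ‖1 - (starRingEnd ℂ) w * z‖ := by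
    have e : 1 - (starRingEnd ℂ) w * (r * z) =
        (1 - (starRingEnd ℂ) w * z) + (1 - (r : ℂ)) * ((starRingEnd ℂ) w * z) := by ring
    have e2 : ‖(1 - (r : ℂ)) * ((starRingEnd ℂ) w * z)‖ ≤ 1 - r := by
      rw [norm_mul, norm_mul, RCLike.norm_conj, ← Complex.ofReal_one, ← Complex.ofReal_sub,
        Complex.norm_real, Real.norm_of_nonneg (by linarith)]
      have : ‖w‖ * ‖z‖ ≤ 1 := by nlinarith [norm_nonneg w, norm_nonneg z]
      nlinarith
    have e3 := norm_sub_norm_le 1 ((starRingEnd ℂ) w * z)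
    rw [norm_mul, RCLike.norm_conj, norm_one] at e3
    have e4 : ‖w‖ * ‖z‖ ≤ r := by nlinarith [norm_nonneg w, norm_nonneg z]
    rw [e]
    refine (norm_add_le _ _).trans ?_
    linarith
  have h2 : 1 - ‖z‖ ^ 2 ≤ 1 - ‖(r : ℂ) * z‖ ^ 2 := by
    rw [norm_mul, hrn, mul_pow]
    have : r ^ 2 ≤ 1 := by nlinarith
    nlinarith [mul_le_mul_of_nonneg_right this (sq_nonneg ‖z‖)]
  have h3 : (1 - ‖z‖ ^ 2) / ‖1 - (starRingEnd ℂ) w * z‖ ^ 2 ≤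
      4 * ((1 - ‖(r : ℂ) * z‖ ^ 2) / ‖1 - (starRingEnd ℂ) w * (r * z)‖ ^ 2) := by
    rw [mul_div_assoc', div_le_div_iff₀ (by positivity) (by positivity)]
    have h4 : ‖1 - (starRingEnd ℂ) w * (r * z)‖ ^ 2 ≤ 4 * ‖1 - (starRingEnd ℂ) w * z‖ ^ 2 := by
      nlinarith
    have := one_sub_normSq_pos hz
    nlinarith [mul_le_mul_of_nonneg_left h4 this.le, mul_le_mul_of_nonneg_right h2
      (by positivity : 0 ≤ 4 * ‖1 - (starRingEnd ℂ) w * z‖ ^ 2)]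
  calc _ ≤ ‖deriv F (r * z)‖ ^ 2 * ‖(r : ℂ)‖ ^ 2 *
        (4 * ((1 - ‖(r : ℂ) * z‖ ^ 2) / ‖1 - (starRingEnd ℂ) w * (r * z)‖ ^ 2)) := by gcongr
    _ = _ := by ring

/-- The Jensen gap of a bounded holomorphic function is controlled by its local Dirichlet
integral. -/
lemma gap_le_dirA {F : ℂ → ℂ} (hF : DifferentiableOn ℂ F disc) {C : ℝ}
    (hC : ∀ z ∈ disc, ‖F z‖ ≤ C) {ρ : ℕ → ℝ} (hρ : ∀ n, ρ n ∈ Ioo 0 1)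
    (hρt : Tendsto ρ atTop (𝓝 1)) {m : ℝ → ℝ}
    (hm : ∀ᵐ t ∂θm, Tendsto (fun n => ‖F (ρ n * bpt t)‖) atTop (𝓝 (m t)))
    {w : ℂ} (hw : w ∈ disc) :
    ENNReal.ofReal (Real.pi * (poissonExt (fun t => m t ^ 2) w - ‖F w‖ ^ 2)) ≤
      8 * (ENNReal.ofReal (1 - ‖w‖ ^ 2) * dirA F w) := by
  have hmem : ∀ n, ∀ z ∈ closedBall (0 : ℂ) 1, (ρ n : ℂ) * z ∈ disc := by
    intro n z hz
    have hz : ‖z‖ ≤ 1 := by simpa using hz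
    rw [mem_disc, norm_mul, Complex.norm_real, Real.norm_of_nonneg (hρ n).1.le]
    nlinarith [norm_nonneg z, (hρ n).1, (hρ n).2]
  have hFc : ∀ n, ContinuousOn (fun z => F (ρ n * z)) (closedBall 0 1) := fun n =>
    hF.continuousOn.comp (by fun_prop) (hmem n)
  have ht1 : Tendsto (fun n => poissonExt (fun t => ‖F (ρ n * bpt t)‖ ^ 2) w) atTop
      (𝓝 (poissonExt (fun t => m t ^ 2) w)) := by
    simp only [poissonExt_eq]
    refine Tendsto.const_mul _ ?_
    refine intervalIntegral.tendsto_integral_filter_of_dominated_convergence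
      (fun t => pk w t * C ^ 2) (Eventually.of_forall fun n => ?_)
      (Eventually.of_forall fun n => ae_of_all _ fun t _ => ?_) ?_ ?_
    · have : Continuous fun t => F (ρ n * bpt t) :=
        (hFc n).comp_continuous continuous_bpt fun t => by simp
      exact (((continuous_pk hw).mul (this.norm.pow 2))).aestronglyMeasurable
    · have h0 := pk_nonneg hw t
      rw [Real.norm_of_nonneg (by positivity)]
      gcongr
      exact hC _ (hmem n _ (by simp))
    · exact ((continuous_pk hw).mul continuous_const).intervalIntegrable _ _
    · rw [uIoc_of_le (by positivity)]
      have hm' := (ae_restrict_iff' measurableSet_Ioc).mp hm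
      filter_upwards [hm'] with t ht hti
      exact ((ht hti).pow 2).const_mul _
  have ht2 : Tendsto (fun n => ‖F (ρ n * w)‖ ^ 2) atTop (𝓝 (‖F w‖ ^ 2)) := by
    have hc : ContinuousAt F w := hF.continuousOn.continuousAt (Metric.isOpen_ball.mem_nhds hw)
    have hs : Tendsto (fun n => (ρ n : ℂ) * w) atTop (𝓝 w) := by
      have := ((Complex.continuous_ofReal.tendsto 1).comp hρt).mul_const w
      simpa using this
    exact ((hc.tendsto.comp hs).norm).pow 2
  have ht3 := ENNReal.tendsto_ofReal ((ht1.sub ht2).const_mul Real.pi)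
  refine le_of_tendsto ht3 ?_
  filter_upwards [hρt.eventually_const_lt (mem_disc.mp hw)] with n hn
  have hd : DifferentiableOn ℂ (fun z => F (ρ n * z)) disc :=
    hF.comp (by fun_prop) fun z hz => hmem n z (ball_subset_closedBall hz)
  refine (poissonExt_sub_le_dirA hd (hFc n) hw).trans ?_
  calc _ ≤ 2 * (ENNReal.ofReal (1 - ‖w‖ ^ 2) * (4 * dirA F w)) := by
        gcongr
        exact dirA_dilation_le hF hw (hρ n).1 (hρ n).2 hn.le
    _ = _ := by ring

/-- The representative in `(0, 2π]` of the argument. -/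
def posArg (z : ℂ) : ℝ := if 0 < arg z then arg z else arg z + 2 * Real.pi

lemma measurable_posArg : Measurable posArg :=
  Measurable.ite (measurableSet_lt measurable_const measurable_arg) measurable_arg
    (measurable_arg.add_const _)

lemma bpt_posArg {z : ℂ} (hz : ‖z‖ = 1) : bpt (posArg z) = z := by
  have h : bpt (arg z) = z := by
    rw [bpt, mul_comm]; simpa [hz] using Complex.norm_mul_exp_arg_mul_I z
  unfold posArg
  split_ifs
  · exact h
  · rw [bpt_add, h]; simp [bpt, mul_comm Complex.I]

lemma posArg_mem (z : ℂ) : posArg z ∈ Ioc 0 (2 * Real.pi) := by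
  have h1 := neg_pi_lt_arg z
  have h2 := arg_le_pi z
  unfold posArg
  split_ifs with h
  · exact ⟨h, by linarith [Real.pi_pos]⟩
  · exact ⟨by linarith, by linarith⟩

lemma injOn_bpt : InjOn bpt (Ioc 0 (2 * Real.pi)) := by
  have h := injOn_circleMap_of_abs_sub_le (c := 0) one_ne_zero
    (a := 0) (b := 2 * Real.pi) (by rw [zero_sub, abs_neg, abs_of_pos Real.two_pi_pos])
  rw [uIoc_of_le Real.two_pi_pos.le] at h
  intro s hs t ht hst
  exact h hs ht (by simpa [bpt_eq_circleMap] using hst)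

lemma posArg_bpt {t : ℝ} (ht : t ∈ Ioc 0 (2 * Real.pi)) : posArg (bpt t) = t :=
  injOn_bpt (posArg_mem _) ht (bpt_posArg (norm_bpt t))

instance : IsFiniteMeasure θm := by unfold θm; infer_instance

lemma ae_θm_mem : ∀ᵐ t ∂θm, t ∈ Ioc 0 (2 * Real.pi) := ae_restrict_mem measurableSet_Ioc

lemma smul_bpt_mem_disc {r : ℝ} (hr : r ∈ Ioo (0 : ℝ) 1) (t : ℝ) : (r : ℂ) * bpt t ∈ disc := by
  rw [mem_disc, norm_mul, norm_bpt, mul_one, Complex.norm_real, Real.norm_of_nonneg hr.1.le]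
  exact hr.2

lemma lintegral_pk {w : ℂ} (hw : w ∈ disc) :
    ∫⁻ t, ENNReal.ofReal (pk w t) ∂θm = ENNReal.ofReal (2 * Real.pi) := by
  rw [← ofReal_integral_eq_lintegral_ofReal]
  · have h := poissonExt_const 1 hw
    rw [poissonExt_eq, intervalIntegral.integral_of_le (by positivity)] at h
    congr 1
    simp only [mul_one] at h
    rw [show ∫ t, pk w t ∂θm = ∫ t in Ioc 0 (2 * Real.pi), pk w t from rfl]
    field_simp at h
    linarith
  · exact per_iff.mp ((continuous_pk hw).intervalIntegrable _ _)
  · exact Eventually.of_forall fun t => pk_nonneg hw t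

lemma pk_smul_bpt_symm (r s t : ℝ) : pk (r * bpt t) s = pk (r * bpt s) t := by
  have h : ∀ x y : ℂ, ‖x‖ = ‖y‖ → ‖x - r * y‖ ^ 2 = ‖y - r * x‖ ^ 2 := by
    intro x y h
    have h' : ‖x‖ ^ 2 = ‖y‖ ^ 2 := by rw [h]
    simp only [← Complex.normSq_eq_norm_sq, Complex.normSq_apply] at h' ⊢
    simp
    linear_combination (1 - r ^ 2) * h'
  rw [pk, pk, h _ _ (by simp)]
  simp

lemma enorm_poissonExt_le (u : ℝ → ℝ) {w : ℂ} (hw : w ∈ disc) :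
    ‖poissonExt u w‖ₑ ≤ ENNReal.ofReal (1 / (2 * Real.pi)) *
      ∫⁻ s, ENNReal.ofReal (pk w s) * ‖u s‖ₑ ∂θm := by
  rw [poissonExt_eq, enorm_mul, Real.enorm_of_nonneg (by positivity),
    intervalIntegral.integral_of_le (by positivity)]
  gcongr
  refine (enorm_integral_le_lintegral_enorm _).trans_eq ?_
  refine lintegral_congr fun s => ?_
  rw [enorm_mul, Real.enorm_of_nonneg (pk_nonneg hw s)]

lemma continuous_poissonExt_smul_bpt {u : ℝ → ℝ} (hu : Per u) {r : ℝ} (hr : r ∈ Ioo (0 : ℝ) 1) :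
    Continuous fun t => poissonExt u (r * bpt t) := by
  have h : Continuous fun t => (herg u (r * bpt t)).re := by
    refine Complex.continuous_re.comp ((differentiableOn_herg hu).continuousOn.comp_continuous
      (by fun_prop) fun t => smul_bpt_mem_disc hr t)
  exact h.congr fun t => re_herg hu (smul_bpt_mem_disc hr t)

/-- The Poisson integral is a contraction in `L¹`. -/
lemma lintegral_poissonExt_le {u : ℝ → ℝ} (hu : Per u) {r : ℝ} (hr : r ∈ Ioo (0 : ℝ) 1) :
    ∫⁻ t, ‖poissonExt u (r * bpt t)‖ₑ ∂θm ≤ ∫⁻ t, ‖u t‖ₑ ∂θm := by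
  have hpk : Continuous fun p : ℝ × ℝ => pk (r * bpt p.1) p.2 := by
    unfold pk
    refine Continuous.div (by fun_prop) (by fun_prop) fun p => ?_
    have := norm_bpt_sub_pos (smul_bpt_mem_disc hr p.1) p.2
    positivity
  calc ∫⁻ t, ‖poissonExt u (r * bpt t)‖ₑ ∂θm
      ≤ ∫⁻ t, ENNReal.ofReal (1 / (2 * Real.pi)) *
        ∫⁻ s, ENNReal.ofReal (pk (r * bpt t) s) * ‖u s‖ₑ ∂θm ∂θm :=
        lintegral_mono fun t => enorm_poissonExt_le u (smul_bpt_mem_disc hr t)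
    _ = ENNReal.ofReal (1 / (2 * Real.pi)) *
        ∫⁻ t, ∫⁻ s, ENNReal.ofReal (pk (r * bpt t) s) * ‖u s‖ₑ ∂θm ∂θm :=
        lintegral_const_mul' _ _ ENNReal.ofReal_ne_top
    _ = ENNReal.ofReal (1 / (2 * Real.pi)) *
        ∫⁻ s, ∫⁻ t, ENNReal.ofReal (pk (r * bpt t) s) * ‖u s‖ₑ ∂θm ∂θm := by
        rw [lintegral_lintegral_swap]
        exact (hpk.measurable.ennreal_ofReal.aemeasurable).mul
          (per_iff.mp hu).aestronglyMeasurable.enorm.comp_snd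
    _ = ENNReal.ofReal (1 / (2 * Real.pi)) *
        ∫⁻ s, ENNReal.ofReal (2 * Real.pi) * ‖u s‖ₑ ∂θm := by
        congr 1
        refine lintegral_congr fun s => ?_
        rw [lintegral_mul_const' _ _ enorm_ne_top, ← lintegral_pk (smul_bpt_mem_disc hr s)]
        simp_rw [pk_smul_bpt_symm r s]
    _ = ∫⁻ s, ‖u s‖ₑ ∂θm := by
        rw [lintegral_const_mul' _ _ ENNReal.ofReal_ne_top, ← mul_assoc,
          ← ENNReal.ofReal_mul (by positivity), one_div_mul_cancel Real.two_pi_pos.ne']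
        simp

lemma exists_continuous_approx {u : ℝ → ℝ} (hu : Per u) {ε : ℝ≥0∞} (hε : ε ≠ 0) :
    ∃ H : ℂ → ℝ, Continuous H ∧ (∃ C, ∀ z, ‖H z‖ ≤ C) ∧
      ∫⁻ t, ‖u t - H (bpt t)‖ₑ ∂θm ≤ ε := by
  have hui := per_iff.mp hu
  set v := hui.aestronglyMeasurable.mk u
  have huv : u =ᵐ[θm] v := hui.aestronglyMeasurable.ae_eq_mk
  have hv : StronglyMeasurable v := hui.aestronglyMeasurable.stronglyMeasurable_mk
  have hvA : StronglyMeasurable (v ∘ posArg) := hv.comp_measurable measurable_posArg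
  have heq : (v ∘ posArg) ∘ bpt =ᵐ[θm] u := by
    filter_upwards [ae_θm_mem, huv] with t ht h
    simp [posArg_bpt ht, h]
  have hint : Integrable (v ∘ posArg) (Measure.map bpt θm) := by
    rw [integrable_map_measure hvA.aestronglyMeasurable continuous_bpt.measurable.aemeasurable]
    exact hui.congr heq.symm
  obtain ⟨H, hHc, hH, hHcont, -⟩ := hint.exists_hasCompactSupport_lintegral_sub_le hε
  refine ⟨H, hHcont, hHc.exists_bound_of_continuous hHcont, ?_⟩
  rw [lintegral_map (by
    exact (hvA.sub hHcont.stronglyMeasurable).enorm) continuous_bpt.measurable] at hH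
  refine le_trans (le_of_eq ?_) hH
  refine lintegral_congr_ae ?_
  filter_upwards [heq] with t ht
  have : (v ∘ posArg) (bpt t) = u t := ht
  rw [this]

lemma tendsto_poissonExt_of_continuous {H : ℂ → ℝ} (hH : Continuous H) {C : ℝ}
    (hC : ∀ z, ‖H z‖ ≤ C) {ρ : ℕ → ℝ} (hρ : ∀ n, ρ n ∈ Ioo (0 : ℝ) 1)
    (hρt : Tendsto ρ atTop (𝓝 1)) {t : ℝ} (ht : t ∈ Ioc 0 (2 * Real.pi)) :
    Tendsto (fun n => poissonExt (fun s => H (bpt s)) (ρ n * bpt t)) atTop (𝓝 (H (bpt t))) := by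
  have h1 : ∀ n, poissonExt (fun s => H (bpt s)) (ρ n * bpt t) =
      (2 * Real.pi)⁻¹ * ∫ s in (0:ℝ)..(2 * Real.pi), H (mob (ρ n * bpt t) (bpt s)) := by
    intro n
    rw [← circleAverage_comp_mob hH.continuousOn (smul_bpt_mem_disc (hρ n) t), Real.circleAverage]
    simp [bpt_eq_circleMap]
  have h2 : H (bpt t) = (2 * Real.pi)⁻¹ * ∫ s in (0:ℝ)..(2 * Real.pi), H (bpt t) := by
    rw [intervalIntegral.integral_const]
    simp only [sub_zero, smul_eq_mul]
    field_simp
  simp_rw [h1]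
  rw [h2]
  refine Tendsto.const_mul _ ?_
  refine intervalIntegral.tendsto_integral_filter_of_dominated_convergence (fun _ => C) ?_ ?_ ?_ ?_
  · refine Eventually.of_forall fun n => Continuous.aestronglyMeasurable ?_
    refine hH.comp (continuous_iff_continuousAt.mpr fun s => ?_)
    exact ContinuousAt.comp (f := bpt) (g := mob _) (hasDerivAt_mob (mem_disc.mp (smul_bpt_mem_disc (hρ n) t))
      (norm_bpt s).le).continuousAt continuous_bpt.continuousAt
  · exact Eventually.of_forall fun n => Eventually.of_forall fun s _ => hC _
  · exact intervalIntegrable_const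
  · have hne : ∀ᵐ s : ℝ, s ≠ t := by simp [ae_iff]
    filter_upwards [hne] with s hs hsm
    rw [uIoc_of_le Real.two_pi_pos.le] at hsm
    have hst : bpt s ≠ bpt t := fun h => hs (injOn_bpt hsm ht h)
    refine (hH.tendsto _).comp ?_
    have h3 : bpt t * (1 - (starRingEnd ℂ) (bpt t) * bpt s) = bpt t - bpt s := by
      rw [conj_bpt]
      linear_combination (- bpt s) * bpt_mul_bpt_neg t
    have h4 : 1 - (starRingEnd ℂ) (bpt t) * bpt s ≠ 0 := by
      intro h
      rw [h, mul_zero] at h3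
      exact hst (sub_eq_zero.mp h3.symm).symm
    have h5 : Tendsto (fun n => (ρ n : ℂ)) atTop (𝓝 1) := by
      simpa [Function.comp_def] using (Complex.continuous_ofReal.tendsto 1).comp hρt
    have h6 : Tendsto (fun n => (ρ n : ℂ) * bpt t) atTop (𝓝 (bpt t)) := by
      simpa using h5.mul_const (bpt t)
    have h7 : Tendsto (fun n => mob (ρ n * bpt t) (bpt s)) atTop
        (𝓝 ((bpt t - bpt s) / (1 - (starRingEnd ℂ) (bpt t) * bpt s))) := by
      unfold mob
      refine Tendsto.div (h6.sub_const _) ?_ h4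
      exact (((Complex.continuous_conj.tendsto _).comp h6).mul_const _).const_sub 1
    rwa [← h3, mul_div_cancel_right₀ _ h4] at h7

lemma tendsto_lintegral_poissonExt_sub {u : ℝ → ℝ} (hu : Per u) {ρ : ℕ → ℝ}
    (hρ : ∀ n, ρ n ∈ Ioo (0 : ℝ) 1) (hρt : Tendsto ρ atTop (𝓝 1)) :
    Tendsto (fun n => ∫⁻ t, ‖poissonExt u (ρ n * bpt t) - u t‖ₑ ∂θm) atTop (𝓝 0) := by
  rw [ENNReal.tendsto_nhds_zero]
  intro ε hε
  have hε3 : ε / 3 ≠ 0 := (ENNReal.div_pos hε.ne' (by norm_num)).ne'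
  obtain ⟨H, hH, ⟨C, hC⟩, hHu⟩ := exists_continuous_approx hu hε3
  have hHp : Per fun t => H (bpt t) := Continuous.intervalIntegrable (by fun_prop) _ _
  have hmid : Tendsto (fun n => ∫⁻ t, ‖poissonExt (fun s => H (bpt s)) (ρ n * bpt t) -
      H (bpt t)‖ₑ ∂θm) atTop (𝓝 0) := by
    have := tendsto_lintegral_of_dominated_convergence (μ := θm)
      (F := fun n t => ‖poissonExt (fun s => H (bpt s)) (ρ n * bpt t) - H (bpt t)‖ₑ)
      (f := fun _ => 0) (fun _ => ENNReal.ofReal (C + C)) ?_ ?_ ?_ ?_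
    · simpa using this
    · intro n
      exact (((continuous_poissonExt_smul_bpt hHp (hρ n)).sub
        (hH.comp continuous_bpt)).measurable).enorm
    · intro n
      refine Eventually.of_forall fun t => ?_
      beta_reduce
      rw [← ofReal_norm]
      refine ENNReal.ofReal_le_ofReal ((norm_sub_le _ _).trans (add_le_add ?_ (hC _)))
      have hw := smul_bpt_mem_disc (hρ n) t
      have hCb : ∀ z, -C ≤ H z ∧ H z ≤ C := fun z => abs_le.mp (hC z)
      rw [Real.norm_eq_abs, abs_le]
      constructor
      · rw [← poissonExt_const (-C) hw]
        exact poissonExt_mono (per_const _) hHp (Eventually.of_forall fun s => (hCb _).1) hw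
      · rw [← poissonExt_const C hw]
        exact poissonExt_mono hHp (per_const _) (Eventually.of_forall fun s => (hCb _).2) hw
    · rw [lintegral_const]
      exact ENNReal.mul_ne_top ENNReal.ofReal_ne_top (measure_ne_top _ _)
    · filter_upwards [ae_θm_mem] with t ht
      have := (tendsto_poissonExt_of_continuous hH hC hρ hρt ht).sub_const (H (bpt t))
      rw [sub_self] at this
      simpa using this.enorm
  filter_upwards [ENNReal.tendsto_nhds_zero.mp hmid (ε / 3) (pos_iff_ne_zero.mpr hε3)] with n hn
  have hsub : Per fun t => u t - H (bpt t) := hu.sub hHp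
  have hms : AEMeasurable (fun t => ‖u t - H (bpt t)‖ₑ) θm :=
    (per_iff.mp hsub).aestronglyMeasurable.enorm
  have hmp : Measurable fun t => ‖poissonExt (fun s => u s - H (bpt s)) (ρ n * bpt t)‖ₑ :=
    (continuous_poissonExt_smul_bpt hsub (hρ n)).measurable.enorm
  calc ∫⁻ t, ‖poissonExt u (ρ n * bpt t) - u t‖ₑ ∂θm
      ≤ ∫⁻ t, ‖poissonExt (fun s => u s - H (bpt s)) (ρ n * bpt t)‖ₑ +
        (‖poissonExt (fun s => H (bpt s)) (ρ n * bpt t) - H (bpt t)‖ₑ +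
          ‖u t - H (bpt t)‖ₑ) ∂θm := by
        refine lintegral_mono fun t => ?_
        rw [show poissonExt u (ρ n * bpt t) - u t =
          poissonExt (fun s => u s - H (bpt s)) (ρ n * bpt t) +
          ((poissonExt (fun s => H (bpt s)) (ρ n * bpt t) - H (bpt t)) - (u t - H (bpt t))) by
            rw [poissonExt_sub hu hHp (smul_bpt_mem_disc (hρ n) t)]; ring]
        exact (enorm_add_le _ _).trans (add_le_add le_rfl enorm_sub_le)
    _ = _ := by rw [lintegral_add_left hmp, lintegral_add_right' _ hms]
    _ ≤ ε / 3 + (ε / 3 + ε / 3) :=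
        add_le_add ((lintegral_poissonExt_le hsub (hρ n)).trans hHu) (add_le_add hn hHu)
    _ = ε := by rw [← add_assoc, ENNReal.add_thirds]

/-- Poisson integrals converge almost everywhere along a sequence of radii. -/
lemma exists_radii_tendsto_poissonExt {u : ℝ → ℝ} (hu : Per u) :
    ∃ ρ : ℕ → ℝ, (∀ n, ρ n ∈ Ioo (0 : ℝ) 1) ∧ Tendsto ρ atTop (𝓝 1) ∧
      ∀ᵐ t ∂θm, Tendsto (fun n => poissonExt u (ρ n * bpt t)) atTop (𝓝 (u t)) := by
  set r : ℕ → ℝ := fun n => 1 - 1 / ((n : ℝ) + 2) with hr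
  have hr1 : ∀ n, r n ∈ Ioo (0 : ℝ) 1 := by
    intro n
    have hn : (0 : ℝ) ≤ n := n.cast_nonneg
    have h1 : 1 / ((n : ℝ) + 2) < 1 := by rw [div_lt_one (by linarith)]; linarith
    have h2 : 0 < 1 / ((n : ℝ) + 2) := by positivity
    exact ⟨by simp only [hr]; linarith, by simp only [hr]; linarith⟩
  have hrt : Tendsto r atTop (𝓝 1) := by
    have h : Tendsto (fun n : ℕ => 1 / ((n : ℝ) + 2)) atTop (𝓝 0) :=
      tendsto_const_nhds.div_atTop
        (tendsto_atTop_add_const_right _ _ tendsto_natCast_atTop_atTop)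
    simpa only [sub_zero] using h.const_sub 1
  have hm : TendstoInMeasure θm (fun n t => poissonExt u (r n * bpt t)) atTop u := by
    refine tendstoInMeasure_of_tendsto_eLpNorm (p := 1) one_ne_zero
      (fun n => (continuous_poissonExt_smul_bpt hu (hr1 n)).aestronglyMeasurable)
      (per_iff.mp hu).aestronglyMeasurable ?_
    simp_rw [eLpNorm_one_eq_lintegral_enorm]
    exact tendsto_lintegral_poissonExt_sub hu hr1 hrt
  obtain ⟨ns, hns, hae⟩ := hm.exists_seq_tendsto_ae
  exact ⟨fun n => r (ns n), fun n => hr1 _, hrt.comp hns.tendsto_atTop, hae⟩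

/-- The closed arc from `bpt a` to `bpt b`. -/
def arc (a b : ℝ) : Set ℂ := {ζ | ∃ s : ℝ, a ≤ s ∧ s ≤ b ∧ ζ = bpt s}

/-- The quadratic polynomial vanishing at the endpoints of the arc. -/
def arcPoly (a b : ℝ) (z : ℂ) : ℂ := (z - bpt a) * (bpt b - z)

lemma norm_bpt_sub_bpt (s t : ℝ) : ‖bpt s - bpt t‖ = 2 * |Real.sin ((s - t) / 2)| := by
  have h : bpt s - bpt t = bpt t * (Complex.exp (Complex.I * ((s - t : ℝ) : ℂ)) - 1) := by
    have h2 := bpt_add (s - t) t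
    rw [sub_add_cancel] at h2
    rw [h2, bpt]
    ring
  rw [h, norm_mul, norm_bpt, one_mul, Complex.norm_exp_I_mul_ofReal_sub_one, norm_mul,
    Real.norm_eq_abs, Real.norm_eq_abs, abs_two]

lemma exists_rep (a s : ℝ) : ∃ s', s' ∈ Ico a (a + 2 * Real.pi) ∧ bpt s' = bpt s := by
  refine ⟨toIcoMod Real.two_pi_pos a s, toIcoMod_mem_Ico _ _ _, ?_⟩
  rw [← self_sub_toIcoDiv_zsmul, bpt_eq_circleMap, bpt_eq_circleMap,
    (periodic_circleMap 0 1).sub_zsmul_eq]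

lemma sin_mul_sin_le {x y u : ℝ} (hx : 0 ≤ x) (hy : 0 ≤ y) (hu : 0 ≤ u)
    (h : u + x + y ≤ Real.pi) : Real.sin x * Real.sin u ≤ Real.sin (x + y) := by
  have hsx := Real.sin_nonneg_of_nonneg_of_le_pi hx (by linarith)
  have hsu := Real.sin_nonneg_of_nonneg_of_le_pi hu (by linarith)
  rcases le_total (x + y) (Real.pi / 2) with h1 | h1
  · have := Real.sin_le_sin_of_le_of_le_pi_div_two (x := x) (y := x + y) (by linarith) h1
      (by linarith)
    nlinarith [Real.sin_le_one u]
  · have := Real.sin_le_sin_of_le_of_le_pi_div_two (x := u) (y := Real.pi - (x + y))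
      (by linarith) (by linarith) (by linarith)
    rw [Real.sin_pi_sub] at this
    nlinarith [Real.sin_le_one x]

lemma norm_arcPoly_le_of_mem {a b : ℝ} {ζ : ℂ} (hζ : ζ ∈ arc a b) {s : ℝ} (hs : bpt s ∉ arc a b) :
    ‖arcPoly a b ζ‖ ≤ 2 * ‖ζ - bpt s‖ := by
  obtain ⟨τ, h1, h2, rfl⟩ := hζ
  obtain ⟨s', ⟨hs1, hs2⟩, hs'⟩ := exists_rep a s
  rw [← hs'] at hs ⊢
  have hbs : b < s' := not_le.mp fun h => hs ⟨s', hs1, h, rfl⟩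
  rw [arcPoly, norm_mul, norm_bpt_sub_bpt, norm_bpt_sub_bpt, norm_sub_rev, norm_bpt_sub_bpt]
  have key := sin_mul_sin_le (x := (b - τ) / 2) (y := (s' - b) / 2) (u := (τ - a) / 2)
    (by linarith) (by linarith) (by linarith) (by linarith)
  rw [show (b - τ) / 2 + (s' - b) / 2 = (s' - τ) / 2 by ring] at key
  rw [abs_of_nonneg (Real.sin_nonneg_of_nonneg_of_le_pi (x := (τ - a) / 2)
    (by linarith) (by linarith)), abs_of_nonneg (Real.sin_nonneg_of_nonneg_of_le_pi
    (x := (b - τ) / 2) (by linarith) (by linarith))]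
  nlinarith [le_abs_self (Real.sin ((s' - τ) / 2))]

lemma arcPoly_sub (a b : ℝ) (z w : ℂ) :
    arcPoly a b z - arcPoly a b w = (z - w) * (bpt a + bpt b - z - w) := by
  unfold arcPoly; ring

lemma norm_arcPoly_sub_le (a b : ℝ) {z w : ℂ} (hz : ‖z‖ ≤ 1) (hw : ‖w‖ ≤ 1) :
    ‖arcPoly a b z - arcPoly a b w‖ ≤ 4 * ‖z - w‖ := by
  rw [arcPoly_sub, norm_mul, mul_comm]
  gcongr
  have h1 := norm_sub_le (bpt a + bpt b - z) w
  have h2 := norm_sub_le (bpt a + bpt b) z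
  have h3 := norm_add_le (bpt a) (bpt b)
  simp only [norm_bpt] at h3
  linarith

lemma norm_arcPoly_le (a b : ℝ) {z : ℂ} (hz : ‖z‖ ≤ 1) : ‖arcPoly a b z‖ ≤ 4 := by
  have h := norm_arcPoly_sub_le a b hz (norm_bpt a).le
  have h2 := norm_sub_le z (bpt a)
  have h3 := norm_sub_le (bpt b) z
  rw [norm_bpt] at h2 h3
  rw [arcPoly, norm_mul]
  nlinarith [norm_nonneg (z - bpt a), norm_nonneg (bpt b - z)]

/-- The arc polynomial is dominated by the distance to points on the other side of the arc. -/
lemma norm_arcPoly_le_of_opposite {a b τ s : ℝ} (h : ¬(bpt τ ∈ arc a b ↔ bpt s ∈ arc a b)) :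
    ‖arcPoly a b (bpt τ)‖ ≤ 6 * ‖bpt τ - bpt s‖ := by
  have h0 := norm_nonneg (bpt τ - bpt s)
  by_cases hτ : bpt τ ∈ arc a b
  · have hs : bpt s ∉ arc a b := by tauto
    linarith [norm_arcPoly_le_of_mem hτ hs]
  · have hs : bpt s ∈ arc a b := by tauto
    have h1 := norm_arcPoly_le_of_mem hs hτ
    have h2 := norm_arcPoly_sub_le a b (norm_bpt τ).le (norm_bpt s).le
    have h3 := norm_add_le (arcPoly a b (bpt τ) - arcPoly a b (bpt s)) (arcPoly a b (bpt s))
    rw [sub_add_cancel] at h3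
    rw [norm_sub_rev] at h1
    linarith

lemma norm_sub_le_two_mul {ζ z : ℂ} (hζ : ‖ζ‖ = 1) (hz : ‖z‖ = 1) {r : ℝ}
    (hr : r ∈ Ioo (0 : ℝ) 1) : ‖ζ - z‖ ≤ 2 * ‖z - r * ζ‖ := by
  have h1 : ‖ζ - z‖ ≤ ‖ζ - r * ζ‖ + ‖z - r * ζ‖ := by
    rw [← norm_sub_rev (r * ζ) z]
    simpa using norm_add_le (ζ - r * ζ) (r * ζ - z)
  have h2 : ‖ζ - r * ζ‖ = 1 - r := by
    rw [show ζ - r * ζ = ((1 - r : ℝ) : ℂ) * ζ by push_cast; ring, norm_mul, hζ, mul_one,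
      Complex.norm_real, Real.norm_of_nonneg (by linarith [hr.2])]
  have h3 := norm_sub_norm_le z (r * ζ)
  rw [norm_mul, hz, hζ, Complex.norm_real, Real.norm_of_nonneg hr.1.le] at h3
  linarith

/-- Poisson averages, at `r ζ`, of functions supported on the other side of the arc from `ζ`. -/
lemma normSq_arcPoly_mul_poissonExt_le {a b τ : ℝ} {k : ℝ → ℝ} (hk : Per k) (hk0 : ∀ t, 0 ≤ k t)
    (hsupp : ∀ t, (bpt τ ∈ arc a b ↔ bpt t ∈ arc a b) → k t = 0) {r : ℝ}
    (hr : r ∈ Ioo (0 : ℝ) 1) :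
    ‖arcPoly a b (bpt τ)‖ ^ 2 * poissonExt k (r * bpt τ) ≤
      (1 - r ^ 2) * (144 * ((1 / (2 * Real.pi)) * ∫ t in (0:ℝ)..(2 * Real.pi), k t)) := by
  have hw := smul_bpt_mem_disc hr τ
  have hpt : ∀ t, ‖arcPoly a b (bpt τ)‖ ^ 2 * (pk (r * bpt τ) t * k t) ≤
      (1 - r ^ 2) * 144 * k t := by
    intro t
    by_cases h : bpt τ ∈ arc a b ↔ bpt t ∈ arc a b
    · simp [hsupp t h]
    · rw [← mul_assoc]
      refine mul_le_mul_of_nonneg_right ?_ (hk0 t)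
      have h1 := norm_arcPoly_le_of_opposite h
      have h2 := norm_sub_le_two_mul (norm_bpt τ) (norm_bpt t) hr
      have h3 := norm_bpt_sub_pos hw t
      have h4 : ‖arcPoly a b (bpt τ)‖ ^ 2 ≤ 144 * ‖bpt t - r * bpt τ‖ ^ 2 := by
        calc ‖arcPoly a b (bpt τ)‖ ^ 2 ≤ (12 * ‖bpt t - r * bpt τ‖) ^ 2 := by
              gcongr; linarith
          _ = _ := by ring
      have h5 : 1 - ‖(r : ℂ) * bpt τ‖ ^ 2 = 1 - r ^ 2 := by
        rw [norm_mul, norm_bpt, mul_one, Complex.norm_real, Real.norm_eq_abs, sq_abs]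
      have h6 : 0 ≤ 1 - r ^ 2 := by rw [← h5]; exact (one_sub_normSq_pos hw).le
      rw [pk, h5, mul_div_assoc', div_le_iff₀ (by positivity)]
      nlinarith
  rw [poissonExt_eq]
  have h := intervalIntegral.integral_mono (μ := volume) Real.two_pi_pos.le
    ((per_pk_mul hw hk).const_mul _) (hk.const_mul _) hpt
  rw [intervalIntegral.integral_const_mul, intervalIntegral.integral_const_mul] at h
  have h2 := mul_le_mul_of_nonneg_left h (by positivity : 0 ≤ 1 / (2 * Real.pi))
  linarith

/-- The Jensen gap of `exp (2 u)` at `w`. -/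
def gap (u : ℝ → ℝ) (w : ℂ) : ℝ :=
  poissonExt (fun t => Real.exp (2 * u t)) w - Real.exp (2 * poissonExt u w)

lemma gap_le_poissonExt_bregman {u : ℝ → ℝ} (hu : Per u) (he : Per fun t => Real.exp (2 * u t))
    (c : ℝ) {w : ℂ} (hw : w ∈ disc) :
    gap u w ≤ poissonExt (fun t => Real.exp (2 * u t) - Real.exp (2 * c) -
      2 * Real.exp (2 * c) * (u t - c)) w := by
  rw [poissonExt_bregman hu he c hw, gap]
  linarith [bregman_nonneg (poissonExt u w) c]

lemma gap_eq_poissonExt_bregman {u : ℝ → ℝ} (hu : Per u) (he : Per fun t => Real.exp (2 * u t))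
    {w : ℂ} (hw : w ∈ disc) :
    gap u w = poissonExt (fun t => Real.exp (2 * u t) - Real.exp (2 * poissonExt u w) -
      2 * Real.exp (2 * poissonExt u w) * (u t - poissonExt u w)) w := by
  rw [poissonExt_bregman hu he _ hw, gap]
  ring

lemma per_bregman {u : ℝ → ℝ} (hu : Per u) (he : Per fun t => Real.exp (2 * u t)) (c : ℝ) :
    Per fun t => Real.exp (2 * u t) - Real.exp (2 * c) - 2 * Real.exp (2 * c) * (u t - c) :=
  (he.sub (per_const _)).sub ((hu.sub (per_const c)).const_mul _)

lemma per_indicator {u : ℝ → ℝ} (hu : Per u) {S : Set ℝ} (hS : MeasurableSet S) :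
    Per (S.indicator u) :=
  per_iff.mpr ((per_iff.mp hu).indicator hS)

lemma indicator_le_of_le {u : ℝ → ℝ} {M : ℝ} (hM0 : 0 ≤ M) (hM : ∀ᵐ t ∂θm, u t ≤ M) (S : Set ℝ) :
    ∀ᵐ t ∂θm, S.indicator u t ≤ M := by
  filter_upwards [hM] with t ht
  by_cases h : t ∈ S <;> simp [h, ht, hM0]

/-- The error function comparing the Jensen gaps of `u` and its truncations. -/
def gapErr (M : ℝ) (u : ℝ → ℝ) (t : ℝ) : ℝ :=
  1 + 2 * M * Real.exp (2 * M) + Real.exp (2 * M) + 2 * |u t|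

lemma gapErr_nonneg {M : ℝ} (hM0 : 0 ≤ M) (u : ℝ → ℝ) (t : ℝ) : 0 ≤ gapErr M u t := by
  unfold gapErr; positivity

lemma per_gapErr (M : ℝ) {u : ℝ → ℝ} (hu : Per u) : Per (gapErr M u) :=
  (per_const _).add (hu.abs.const_mul 2)

/-- Truncating to `S` changes the Jensen gap by at most the mass off `S`. -/
lemma gap_indicator_le_gap_add {u : ℝ → ℝ} (hu : Per u) {M : ℝ} (hM0 : 0 ≤ M)
    (hM : ∀ᵐ t ∂θm, u t ≤ M) {S : Set ℝ} (hS : MeasurableSet S) {w : ℂ} (hw : w ∈ disc) :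
    gap (S.indicator u) w ≤ gap u w + poissonExt (Sᶜ.indicator (gapErr M u)) w := by
  have he := per_exp_two_mul hu hM
  have hQ := per_indicator hu hS
  have heQ := per_exp_two_mul hQ (indicator_le_of_le hM0 hM S)
  have hE := per_indicator (per_gapErr M hu) hS.compl
  set c := poissonExt u w with hc
  have hcM : c ≤ M := by
    rw [← poissonExt_const M hw]; exact poissonExt_mono hu (per_const _) hM hw
  refine (gap_le_poissonExt_bregman hQ heQ c hw).trans ?_
  rw [gap_eq_poissonExt_bregman hu he hw, ← hc, ← poissonExt_add (per_bregman hu he c) hE hw]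
  refine poissonExt_mono (per_bregman hQ heQ c) ((per_bregman hu he c).add hE) ?_ hw
  refine Eventually.of_forall fun t => ?_
  by_cases ht : t ∈ S
  · simp [ht]
  · simp only [ht, not_false_eq_true, indicator_of_notMem, mem_compl_iff, indicator_of_mem,
      mul_zero, Real.exp_zero]
    have h1 := bregman_nonneg (u t) c
    have h2 : c * Real.exp (2 * c) ≤ M * Real.exp (2 * M) := by
      rcases le_total c 0 with h | h
      · exact (mul_nonpos_of_nonpos_of_nonneg h (Real.exp_pos _).le).trans (by positivity)
      · gcongr
    unfold gapErr
    nlinarith [abs_nonneg (u t), Real.exp_pos (2 * M), Real.exp_pos (2 * c)]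

lemma gap_indicator_le {u : ℝ → ℝ} (hu : Per u) {M : ℝ} (hM0 : 0 ≤ M)
    (hM : ∀ᵐ t ∂θm, u t ≤ M) {S : Set ℝ} (hS : MeasurableSet S) {w : ℂ} (hw : w ∈ disc) :
    gap (S.indicator u) w ≤ poissonExt (S.indicator (gapErr M u)) w := by
  have hQ := per_indicator hu hS
  have heQ := per_exp_two_mul hQ (indicator_le_of_le hM0 hM S)
  have hE := per_indicator (per_gapErr M hu) hS
  refine (gap_le_poissonExt_bregman hQ heQ 0 hw).trans ?_
  refine poissonExt_mono (per_bregman hQ heQ 0) hE ?_ hw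
  filter_upwards [hM] with t hMt
  by_cases ht : t ∈ S
  · simp only [ht, indicator_of_mem, mul_zero, Real.exp_zero]
    have h1 : Real.exp (2 * u t) ≤ Real.exp (2 * M) := by gcongr
    unfold gapErr
    nlinarith [neg_abs_le (u t), mul_nonneg hM0 (Real.exp_pos (2 * M)).le]
  · simp [ht]

lemma norm_exp_herg_le {u : ℝ → ℝ} (hu : Per u) {M : ℝ} (hM : ∀ᵐ t ∂θm, u t ≤ M) {z : ℂ}
    (hz : z ∈ disc) : ‖Complex.exp (herg u z)‖ ≤ Real.exp M := by
  rw [norm_exp_herg hu hz]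
  gcongr
  rw [← poissonExt_const M hz]
  exact poissonExt_mono hu (per_const _) hM hz

lemma differentiableOn_exp_herg {u : ℝ → ℝ} (hu : Per u) :
    DifferentiableOn ℂ (fun z => Complex.exp (herg u z)) disc :=
  (differentiableOn_herg hu).cexp

lemma exists_radii_tendsto_norm_exp_herg {u : ℝ → ℝ} (hu : Per u) :
    ∃ ρ : ℕ → ℝ, (∀ n, ρ n ∈ Ioo (0 : ℝ) 1) ∧ Tendsto ρ atTop (𝓝 1) ∧
      ∀ᵐ t ∂θm, Tendsto (fun n => ‖Complex.exp (herg u (ρ n * bpt t))‖) atTop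
        (𝓝 (Real.exp (u t))) := by
  obtain ⟨ρ, hρ, hρt, h⟩ := exists_radii_tendsto_poissonExt hu
  refine ⟨ρ, hρ, hρt, ?_⟩
  filter_upwards [h] with t ht
  simp_rw [norm_exp_herg hu (smul_bpt_mem_disc (hρ _) t)]
  exact (Real.continuous_exp.tendsto _).comp ht

/-- The Jensen gap of `u` is controlled by the local Dirichlet integral of the outer function. -/
lemma ofReal_gap_le {u : ℝ → ℝ} (hu : Per u) {M : ℝ} (hM : ∀ᵐ t ∂θm, u t ≤ M) {w : ℂ}
    (hw : w ∈ disc) : ENNReal.ofReal (Real.pi * gap u w) ≤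
      8 * (ENNReal.ofReal (1 - ‖w‖ ^ 2) * dirA (fun z => Complex.exp (herg u z)) w) := by
  obtain ⟨ρ, hρ, hρt, h⟩ := exists_radii_tendsto_norm_exp_herg hu
  have := gap_le_dirA (differentiableOn_exp_herg hu) (fun z hz => norm_exp_herg_le hu hM hz)
    hρ hρt h hw
  rw [norm_exp_herg_sq hu hw] at this
  simp_rw [← Real.exp_nat_mul] at this
  exact_mod_cast this

lemma isClosed_arc (a b : ℝ) : IsClosed (arc a b) := by
  have : arc a b = bpt '' Icc a b := by
    ext ζ
    constructor
    · rintro ⟨s, h1, h2, rfl⟩; exact ⟨s, ⟨h1, h2⟩, rfl⟩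
    · rintro ⟨s, ⟨h1, h2⟩, rfl⟩; exact ⟨s, h1, h2, rfl⟩
  rw [this]
  exact (isCompact_Icc.image continuous_bpt).isClosed

lemma measurableSet_preimage_arc (a b : ℝ) : MeasurableSet (bpt ⁻¹' arc a b) :=
  ((isClosed_arc a b).preimage continuous_bpt).measurableSet

lemma normSq_arcPoly_mul_gap_le {a b τ : ℝ} {u : ℝ → ℝ} (hu : Per u) {M : ℝ} (hM0 : 0 ≤ M)
    (hM : ∀ᵐ t ∂θm, u t ≤ M) {r : ℝ} (hr : r ∈ Ioo (0 : ℝ) 1) :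
    ‖arcPoly a b (bpt τ)‖ ^ 2 * gap ((bpt ⁻¹' arc a b).indicator u) (r * bpt τ) ≤
      16 * gap u (r * bpt τ) + (1 - r ^ 2) *
        (144 * ((1 / (2 * Real.pi)) * ∫ t in (0:ℝ)..(2 * Real.pi), gapErr M u t)) := by
  have hw := smul_bpt_mem_disc hr τ
  have hS := measurableSet_preimage_arc a b
  set S := bpt ⁻¹' arc a b with hSdef
  have hp : ‖arcPoly a b (bpt τ)‖ ^ 2 ≤ 16 := by
    have := norm_arcPoly_le a b (norm_bpt τ).le
    nlinarith [norm_nonneg (arcPoly a b (bpt τ))]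
  have hp0 : 0 ≤ ‖arcPoly a b (bpt τ)‖ ^ 2 := by positivity
  have hgap0 : 0 ≤ gap u (r * bpt τ) :=
    sub_nonneg.mpr (exp_two_mul_poissonExt_le hu (per_exp_two_mul hu hM) hw)
  have hr2 : 0 ≤ 1 - r ^ 2 := by nlinarith [hr.1, hr.2]
  have main : ∀ T : Set ℝ, MeasurableSet T →
      (∀ t, (bpt τ ∈ arc a b ↔ bpt t ∈ arc a b) → t ∉ T) →
      ‖arcPoly a b (bpt τ)‖ ^ 2 * poissonExt (T.indicator (gapErr M u)) (r * bpt τ) ≤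
        (1 - r ^ 2) *
        (144 * ((1 / (2 * Real.pi)) * ∫ t in (0:ℝ)..(2 * Real.pi), gapErr M u t)) := by
    intro T hT hTs
    refine (normSq_arcPoly_mul_poissonExt_le (per_indicator (per_gapErr M hu) hT)
      (fun t => indicator_nonneg (fun t _ => gapErr_nonneg hM0 u t) t)
      (fun t ht => indicator_of_notMem (hTs t ht) _) hr).trans ?_
    gcongr
    refine intervalIntegral.integral_mono Real.two_pi_pos.le
      (per_indicator (per_gapErr M hu) hT) (per_gapErr M hu) fun t => ?_
    exact indicator_le_self' (fun t _ => gapErr_nonneg hM0 u t) t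
  by_cases hτ : bpt τ ∈ arc a b
  · have h1 := gap_indicator_le_gap_add hu hM0 hM hS hw
    have h2 := main Sᶜ hS.compl fun t ht h => h (ht.mp hτ)
    nlinarith
  · have h1 := gap_indicator_le hu hM0 hM hS hw
    have h2 := main S hS fun t ht h => hτ (ht.mpr h)
    nlinarith

lemma dirA_smul_le {F : ℂ → ℂ} {ζ : ℂ} (hζ : ‖ζ‖ = 1) {r : ℝ} (hr : r ∈ Ioo (0 : ℝ) 1) :
    dirA F (r * ζ) ≤ 4 * dirA F ζ := by
  rw [dirA, dirA, ← lintegral_const_mul' _ _ (by norm_num)]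
  refine setLIntegral_mono' measurableSet_disc fun z hz => ?_
  have hz' := mem_disc.mp hz
  have hrζ : ‖(r : ℂ) * ζ‖ = r := by
    rw [norm_mul, hζ, mul_one, Complex.norm_real, Real.norm_of_nonneg hr.1.le]
  have h1 := norm_one_sub_conj_mul_pos hζ.le hz'
  have h2 := norm_one_sub_conj_mul_pos (w := r * ζ) (by rw [hrζ]; exact hr.2.le) hz'
  have h3 : ‖1 - (starRingEnd ℂ) ζ * z‖ ≤ 2 * ‖1 - (starRingEnd ℂ) (r * ζ) * z‖ := by
    have e : (starRingEnd ℂ) (r * ζ) * z = r * ((starRingEnd ℂ) ζ * z) := by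
      rw [map_mul, Complex.conj_ofReal]; ring
    rw [e]
    set v := (starRingEnd ℂ) ζ * z
    have hv : ‖v‖ ≤ 1 := by rw [norm_mul, RCLike.norm_conj, hζ, one_mul]; exact hz'.le
    have h4 := norm_sub_norm_le 1 ((r : ℂ) * v)
    have h5 := norm_sub_le (1 - (r : ℂ) * v) (((1 - r : ℝ) : ℂ) * v)
    rw [show 1 - (r : ℂ) * v - ((1 - r : ℝ) : ℂ) * v = 1 - v by push_cast; ring] at h5
    rw [norm_one, norm_mul, Complex.norm_real, Real.norm_of_nonneg hr.1.le] at h4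
    rw [norm_mul, Complex.norm_real, Real.norm_of_nonneg (by linarith [hr.2])] at h5
    nlinarith [hr.1, hr.2]
  rw [show (4 : ℝ≥0∞) = ENNReal.ofReal 4 by norm_num, ← ENNReal.ofReal_mul (by norm_num)]
  refine ENNReal.ofReal_le_ofReal ?_
  rw [mul_left_comm]
  refine mul_le_mul_of_nonneg_left ?_ (by positivity)
  have h6 : 0 ≤ 1 - ‖z‖ ^ 2 := by nlinarith [norm_nonneg z]
  rw [mul_div_assoc', div_le_div_iff₀ (by positivity) (by positivity)]
  have h7 : ‖1 - (starRingEnd ℂ) ζ * z‖ ^ 2 ≤ 4 * ‖1 - (starRingEnd ℂ) (r * ζ) * z‖ ^ 2 := by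
    nlinarith
  nlinarith

lemma dirA_le_liminf (F : ℂ → ℂ) {ζ : ℂ} (hζ : ‖ζ‖ = 1) {ρ : ℕ → ℝ}
    (hρt : Tendsto ρ atTop (𝓝 1)) :
    dirA F ζ ≤ liminf (fun n => dirA F (ρ n * ζ)) atTop := by
  refine le_trans ?_ (lintegral_liminf_le fun n => ?_)
  · refine setLIntegral_mono' measurableSet_disc fun z hz => ?_
    refine (Tendsto.liminf_eq ?_).ge
    refine (ENNReal.continuous_ofReal.tendsto _).comp (Tendsto.const_mul _ ?_)
    have h1 := norm_one_sub_conj_mul_pos hζ.le (mem_disc.mp hz)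
    refine Tendsto.div tendsto_const_nhds ?_ (by positivity)
    have h5 : Tendsto (fun n => (ρ n : ℂ) * ζ) atTop (𝓝 ζ) := by
      have : Tendsto (fun n => (ρ n : ℂ)) atTop (𝓝 1) := by
        simpa [Function.comp_def] using (Complex.continuous_ofReal.tendsto 1).comp hρt
      simpa using this.mul_const ζ
    exact ((((Complex.continuous_conj.tendsto _).comp h5).mul_const z).const_sub 1).norm.pow 2
  · have := measurable_deriv F
    fun_prop

/-- The local Dirichlet integrals of the truncated outer function, weighted by the arc polynomial,
are controlled by those of the original function. -/
lemma normSq_arcPoly_mul_dirA_le {u : ℝ → ℝ} (hu : Per u) {M : ℝ} (hM0 : 0 ≤ M)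
    (hM : ∀ᵐ t ∂θm, u t ≤ M) (a b : ℝ) :
    ∃ K : ℝ, ∀ ζ : ℂ, ‖ζ‖ = 1 →
      ENNReal.ofReal (‖arcPoly a b ζ‖ ^ 2) *
        dirA (fun z => Complex.exp (herg ((bpt ⁻¹' arc a b).indicator u) z)) ζ ≤
      512 * dirA (fun z => Complex.exp (herg u z)) ζ + ENNReal.ofReal K := by
  set κ := 144 * ((1 / (2 * Real.pi)) * ∫ t in (0:ℝ)..(2 * Real.pi), gapErr M u t) with hκ
  have hκ0 : 0 ≤ κ := by
    have := intervalIntegral.integral_nonneg (μ := volume) Real.two_pi_pos.le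
      (fun t _ => gapErr_nonneg hM0 u t)
    positivity
  refine ⟨Real.pi * κ, fun ζ hζ => ?_⟩
  obtain ⟨τ, rfl⟩ := exists_bpt_eq hζ
  set Q := (bpt ⁻¹' arc a b).indicator u
  set f := fun z => Complex.exp (herg u z)
  set g := fun z => Complex.exp (herg Q z)
  have hS := measurableSet_preimage_arc a b
  have hQ : Per Q := per_indicator hu hS
  have heQ := per_exp_two_mul hQ (indicator_le_of_le hM0 hM _)
  have radial : ∀ r ∈ Ioo (0 : ℝ) 1, ENNReal.ofReal (‖arcPoly a b (bpt τ)‖ ^ 2) *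
      dirA g (r * bpt τ) ≤ 512 * dirA f (bpt τ) + ENNReal.ofReal (Real.pi * κ) := by
    intro r hr
    have hw := smul_bpt_mem_disc hr τ
    have hnorm : ‖(r : ℂ) * bpt τ‖ ^ 2 = r ^ 2 := by
      rw [norm_mul, norm_bpt, mul_one, Complex.norm_real, Real.norm_eq_abs, sq_abs]
    have hpos := one_sub_normSq_pos hw
    have h1 := dirA_exp_herg_le hQ heQ hw
    have h2 := ofReal_gap_le hu hM hw
    have h3 := normSq_arcPoly_mul_gap_le (a := a) (b := b) (τ := τ) hu hM0 hM hr
    have hgap0 : 0 ≤ gap u (r * bpt τ) :=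
      sub_nonneg.mpr (exp_two_mul_poissonExt_le hu (per_exp_two_mul hu hM) hw)
    rw [hnorm] at h1 h2 hpos
    set e := ENNReal.ofReal (1 - r ^ 2)
    have key : e * (ENNReal.ofReal (‖arcPoly a b (bpt τ)‖ ^ 2) * dirA g (r * bpt τ)) ≤
        e * (128 * dirA f (r * bpt τ) + ENNReal.ofReal (Real.pi * κ)) := by
      calc e * (ENNReal.ofReal (‖arcPoly a b (bpt τ)‖ ^ 2) * dirA g (r * bpt τ))
          = ENNReal.ofReal (‖arcPoly a b (bpt τ)‖ ^ 2) * (e * dirA g (r * bpt τ)) := by ring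
        _ ≤ ENNReal.ofReal (‖arcPoly a b (bpt τ)‖ ^ 2) *
            ENNReal.ofReal (Real.pi * gap Q (r * bpt τ)) := mul_le_mul_right h1 _
        _ = ENNReal.ofReal (Real.pi * (‖arcPoly a b (bpt τ)‖ ^ 2 * gap Q (r * bpt τ))) := by
            rw [← ENNReal.ofReal_mul (by positivity)]; ring_nf
        _ ≤ ENNReal.ofReal (16 * (Real.pi * gap u (r * bpt τ)) +
            (1 - r ^ 2) * (Real.pi * κ)) := by
            refine ENNReal.ofReal_le_ofReal ?_
            have := mul_le_mul_of_nonneg_left h3 Real.pi_pos.le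
            rw [← hκ] at this
            linarith
        _ = 16 * ENNReal.ofReal (Real.pi * gap u (r * bpt τ)) +
            e * ENNReal.ofReal (Real.pi * κ) := by
            rw [ENNReal.ofReal_add (by positivity) (by positivity),
              ENNReal.ofReal_mul (by norm_num), ENNReal.ofReal_mul hpos.le]
            norm_num
            rfl
        _ ≤ 16 * (8 * (e * dirA f (r * bpt τ))) + e * ENNReal.ofReal (Real.pi * κ) := by
            gcongr
        _ = _ := by ring
    have key2 := (ENNReal.mul_le_mul_iff_right (ENNReal.ofReal_pos.mpr hpos).ne'
      ENNReal.ofReal_ne_top).mp key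
    refine key2.trans (add_le_add_left ?_ _)
    calc 128 * dirA f (r * bpt τ) ≤ 128 * (4 * dirA f (bpt τ)) := by
          gcongr; exact dirA_smul_le (norm_bpt τ) hr
      _ = 512 * dirA f (bpt τ) := by ring
  rcases eq_or_ne (ENNReal.ofReal (‖arcPoly a b (bpt τ)‖ ^ 2)) 0 with h0 | h0
  · rw [h0, zero_mul]; exact bot_le
  obtain ⟨ρ, hρ, hρt, -⟩ := exists_radii_tendsto_poissonExt hu
  rw [mul_comm, ← ENNReal.le_div_iff_mul_le (Or.inl h0) (Or.inl ENNReal.ofReal_ne_top)]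
  refine (dirA_le_liminf g (norm_bpt τ) hρt).trans ?_
  refine liminf_le_of_frequently_le' (Eventually.of_forall fun n => ?_).frequently
  rw [ENNReal.le_div_iff_mul_le (Or.inl h0) (Or.inl ENNReal.ofReal_ne_top), mul_comm]
  exact radial (ρ n) (hρ n)

lemma dirA_congr {F G : ℂ → ℂ} (h : EqOn F G disc) (w : ℂ) : dirA F w = dirA G w := by
  refine setLIntegral_congr_fun measurableSet_disc fun z hz => ?_
  rw [(h.eventuallyEq_of_mem (Metric.isOpen_ball.mem_nhds hz)).deriv_eq]

lemma dirA_id_le {ζ : ℂ} (hζ : ‖ζ‖ = 1) : dirA id ζ ≤ ENNReal.ofReal Real.pi := by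
  have h : ∀ w ∈ disc, dirA id w ≤ ENNReal.ofReal Real.pi := by
    intro w hw
    have hpos := one_sub_normSq_pos hw
    have hd := differentiableOn_mob hw
    have key : ENNReal.ofReal (1 - ‖w‖ ^ 2) * dirA id w ≤
        ENNReal.ofReal (1 - ‖w‖ ^ 2) * ENNReal.ofReal Real.pi := by
      rw [← dirA_comp_mob differentiableOn_id hw, dirA_zero, ← ENNReal.ofReal_mul hpos.le,
        Function.id_comp]
      refine (lintegral_deriv_sq_weight_le hd (M := 1) fun r hr0 hr1 => ?_).trans_eq ?_
      · have hsub : sphere (0 : ℂ) |r| ⊆ disc := by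
          rw [abs_of_pos hr0]
          exact sphere_subset_closedBall.trans (closedBall_subset_ball hr1)
        rw [← Real.circleAverage_const (1 : ℝ) 0 r]
        refine Real.circleAverage_mono
          (ContinuousOn.circleIntegrable' ((hd.continuousOn.mono hsub).norm.pow 2))
          (circleIntegrable_const _ _ _) fun z hz => ?_
        have := mem_disc.mp (mob_mem_disc hw (hsub hz))
        exact pow_le_one₀ (norm_nonneg _) this.le
      · rw [mob_zero, mul_comm]
    exact (ENNReal.mul_le_mul_iff_right (ENNReal.ofReal_pos.mpr hpos).ne'
      ENNReal.ofReal_ne_top).mp key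
  obtain ⟨ρ, hρ, hρt, -⟩ := exists_radii_tendsto_poissonExt (per_const 0)
  obtain ⟨s, rfl⟩ := exists_bpt_eq hζ
  refine (dirA_le_liminf id (norm_bpt s) hρt).trans ?_
  exact liminf_le_of_frequently_le'
    (Eventually.of_forall fun n => h _ (smul_bpt_mem_disc (hρ n) s)).frequently

lemma hasDerivAt_arcPoly (a b : ℝ) (z : ℂ) :
    HasDerivAt (arcPoly a b) (bpt a + bpt b - 2 * z) z := by
  have h := ((hasDerivAt_id z).sub_const (bpt a)).mul ((hasDerivAt_id z).const_sub (bpt b))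
  exact h.congr_deriv (by simp; ring)

/-- Local Dirichlet integral of a product with the arc polynomial. -/
lemma dirA_arcPoly_mul_le {g : ℂ → ℂ} (hg : DifferentiableOn ℂ g disc) {C : ℝ}
    (hC : ∀ z ∈ disc, ‖g z‖ ≤ C) (a b : ℝ) {ζ : ℂ} (hζ : ‖ζ‖ = 1) :
    dirA (fun z => arcPoly a b z * g z) ζ ≤
      4 * (ENNReal.ofReal (‖arcPoly a b ζ‖ ^ 2) * dirA g ζ) + 64 * dirA g 0 +
        ENNReal.ofReal (32 * C ^ 2) * ENNReal.ofReal Real.pi := by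
  refine le_trans ?_ (add_le_add_right (mul_le_mul_right (dirA_id_le hζ) _) _)
  have hm := measurable_deriv g
  have e4 : (4 : ℝ≥0∞) = ENNReal.ofReal 4 := by norm_num
  have e64 : (64 : ℝ≥0∞) = ENNReal.ofReal 64 := by norm_num
  rw [dirA, dirA, dirA, dirA, ← lintegral_const_mul' _ _ ENNReal.ofReal_ne_top,
    ← lintegral_const_mul' _ _ (by norm_num), ← lintegral_const_mul' _ _ (by norm_num),
    ← lintegral_const_mul' _ _ ENNReal.ofReal_ne_top,
    ← lintegral_add_left (by fun_prop), ← lintegral_add_left (by fun_prop)]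
  refine setLIntegral_mono' measurableSet_disc fun z hz => ?_
  have hz' := mem_disc.mp hz
  have hgz := (hg.differentiableAt (Metric.isOpen_ball.mem_nhds hz)).hasDerivAt
  have hd : deriv (fun z => arcPoly a b z * g z) z =
      (bpt a + bpt b - 2 * z) * g z + arcPoly a b z * deriv g z :=
    ((hasDerivAt_arcPoly a b z).mul hgz).deriv
  rw [hd, deriv_id, e4, e64,
    ← ENNReal.ofReal_mul (by positivity), ← ENNReal.ofReal_mul (by norm_num),
    ← ENNReal.ofReal_mul (by norm_num), ← ENNReal.ofReal_mul (by positivity)]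
  have h1 := norm_one_sub_conj_mul_pos hζ.le hz'
  have hw0 : 0 ≤ 1 - ‖z‖ ^ 2 := by nlinarith [norm_nonneg z]
  rw [← ENNReal.ofReal_add (by positivity) (by simp; positivity),
    ← ENNReal.ofReal_add (by simp; positivity) (by positivity)]
  refine ENNReal.ofReal_le_ofReal ?_
  have hsq := normSq_one_sub_conj_mul ζ z
  rw [hζ] at hsq
  have hsq' : ‖1 - (starRingEnd ℂ) ζ * z‖ ^ 2 = ‖z - ζ‖ ^ 2 := by
    rw [norm_sub_rev z ζ]; linarith
  set D := ‖1 - (starRingEnd ℂ) ζ * z‖ ^ 2 with hD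
  have hD0 : 0 < D := by positivity
  have hp' : ‖bpt a + bpt b - 2 * z‖ ≤ 4 := by
    have h3 := norm_sub_le (bpt a + bpt b) (2 * z)
    have h4 := norm_add_le (bpt a) (bpt b)
    rw [norm_mul] at h3
    simp only [norm_bpt, RCLike.norm_ofNat] at h3 h4
    linarith
  have hp : ‖arcPoly a b z‖ ^ 2 ≤ 2 * ‖arcPoly a b ζ‖ ^ 2 + 32 * D := by
    have h3 := norm_add_le (arcPoly a b z - arcPoly a b ζ) (arcPoly a b ζ)
    rw [sub_add_cancel] at h3
    have h4 := norm_arcPoly_sub_le a b hz'.le hζ.le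
    calc ‖arcPoly a b z‖ ^ 2 ≤ (4 * ‖z - ζ‖ + ‖arcPoly a b ζ‖) ^ 2 := by
          gcongr; linarith
      _ ≤ _ := by rw [hsq']; nlinarith [sq_nonneg (4 * ‖z - ζ‖ - ‖arcPoly a b ζ‖)]
  have hF : ‖(bpt a + bpt b - 2 * z) * g z + arcPoly a b z * deriv g z‖ ^ 2 ≤
      32 * C ^ 2 + 2 * (‖arcPoly a b z‖ ^ 2 * ‖deriv g z‖ ^ 2) := by
    have h3 := norm_add_le ((bpt a + bpt b - 2 * z) * g z) (arcPoly a b z * deriv g z)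
    rw [norm_mul, norm_mul (arcPoly a b z)] at h3
    have h4 : ‖bpt a + bpt b - 2 * z‖ * ‖g z‖ ≤ 4 * C :=
      mul_le_mul hp' (hC z hz) (norm_nonneg _) (by norm_num)
    calc _ ≤ (4 * C + ‖arcPoly a b z‖ * ‖deriv g z‖) ^ 2 := by gcongr; linarith
      _ ≤ _ := by nlinarith [sq_nonneg (4 * C - ‖arcPoly a b z‖ * ‖deriv g z‖)]
  have hF2 : ‖(bpt a + bpt b - 2 * z) * g z + arcPoly a b z * deriv g z‖ ^ 2 ≤
      32 * C ^ 2 + 4 * ‖arcPoly a b ζ‖ ^ 2 * ‖deriv g z‖ ^ 2 + 64 * D * ‖deriv g z‖ ^ 2 := by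
    nlinarith [mul_le_mul_of_nonneg_right hp (sq_nonneg ‖deriv g z‖)]
  calc _ ≤ (32 * C ^ 2 + 4 * ‖arcPoly a b ζ‖ ^ 2 * ‖deriv g z‖ ^ 2 +
        64 * D * ‖deriv g z‖ ^ 2) * ((1 - ‖z‖ ^ 2) / D) := by gcongr
    _ = _ := by simp only [map_zero, zero_mul, sub_zero, norm_one, one_pow, div_one]; field_simp; ring

lemma measurable_poissonKernel : Measurable fun p : ℂ × ℂ =>
    (1 - ‖p.1‖ ^ 2) / ‖1 - (starRingEnd ℂ) p.2 * p.1‖ ^ 2 := by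
  have : Measurable fun p : ℂ × ℂ => (starRingEnd ℂ) p.2 :=
    Complex.continuous_conj.measurable.comp measurable_snd
  fun_prop

lemma ofReal_poissonMu {μ : Measure ℂ} [IsFiniteMeasure μ] (hμ : OnCircle μ) {z : ℂ}
    (hz : z ∈ disc) : ENNReal.ofReal (poissonMu μ z) =
      ∫⁻ ζ, ENNReal.ofReal ((1 - ‖z‖ ^ 2) / ‖1 - (starRingEnd ℂ) ζ * z‖ ^ 2) ∂μ := by
  have hz' := mem_disc.mp hz
  have hw0 := one_sub_normSq_pos hz
  have hae : ∀ᵐ ζ ∂μ, ζ ∈ circleT := by rw [ae_iff]; exact hμ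
  refine ofReal_integral_eq_lintegral_ofReal ?_ (Eventually.of_forall fun ζ => by positivity)
  refine Integrable.of_bound (C := (1 - ‖z‖ ^ 2) / (1 - ‖z‖) ^ 2)
    (measurable_poissonKernel.comp (measurable_const.prodMk measurable_id)).aestronglyMeasurable ?_
  filter_upwards [hae] with ζ hζ
  have hζ1 : ‖ζ‖ = 1 := by simpa [circleT] using hζ
  rw [Real.norm_of_nonneg (by positivity)]
  have h := norm_sub_norm_le 1 ((starRingEnd ℂ) ζ * z)
  rw [norm_mul, RCLike.norm_conj, norm_one, hζ1, one_mul] at h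
  have h2 : 0 < 1 - ‖z‖ := by linarith
  gcongr

lemma integrableOn_dirichletDensity_iff {μ : Measure ℂ} [IsFiniteMeasure μ] (hμ : OnCircle μ)
    (F : ℂ → ℂ) :
    IntegrableOn (dirichletDensity μ F) disc ↔ ∫⁻ ζ, dirA F ζ ∂μ < ∞ := by
  have hd := measurable_deriv F
  have hmeas : Measurable (dirichletDensity μ F) := by
    unfold dirichletDensity
    refine (hd.norm.pow_const 2).mul ?_
    exact measurable_poissonKernel.stronglyMeasurable.integral_prod_right'.measurable
  have hjoint : Measurable fun p : ℂ × ℂ => ENNReal.ofReal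
      (‖deriv F p.2‖ ^ 2 * ((1 - ‖p.2‖ ^ 2) / ‖1 - (starRingEnd ℂ) p.1 * p.2‖ ^ 2)) :=
    (((hd.comp measurable_snd).norm.pow_const 2).mul
      (measurable_poissonKernel.comp measurable_swap)).ennreal_ofReal
  unfold dirA
  rw [lintegral_lintegral_swap hjoint.aemeasurable, IntegrableOn, Integrable,
    and_iff_right hmeas.aestronglyMeasurable, HasFiniteIntegral]
  have : ∫⁻ z in disc, ‖dirichletDensity μ F z‖ₑ = ∫⁻ z in disc, ∫⁻ ζ, ENNReal.ofReal
      (‖deriv F z‖ ^ 2 * ((1 - ‖z‖ ^ 2) / ‖1 - (starRingEnd ℂ) ζ * z‖ ^ 2)) ∂μ := by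
    refine setLIntegral_congr_fun measurableSet_disc fun z hz => ?_
    have hw0 := one_sub_normSq_pos hz
    have hP : 0 ≤ poissonMu μ z := integral_nonneg fun ζ => by positivity
    rw [dirichletDensity, Real.enorm_of_nonneg (by positivity), ENNReal.ofReal_mul (by positivity),
      ofReal_poissonMu hμ hz, ← lintegral_const_mul' _ _ ENNReal.ofReal_ne_top]
    refine lintegral_congr fun ζ => ?_
    rw [← ENNReal.ofReal_mul (by positivity)]
  rw [this]

lemma per_log_norm_bpt_sub (a : ℝ) : Per fun t => Real.log ‖bpt t - bpt a‖ := by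
  have h := circleIntegrable_log_norm_sub_const (c := 0) (a := bpt a) 1
  unfold CircleIntegrable at h
  simpa only [← bpt_eq_circleMap] using h

lemma poissonExt_log_norm_bpt_sub (a : ℝ) {w : ℂ} (hw : w ∈ disc) :
    poissonExt (fun t => Real.log ‖bpt t - bpt a‖) w = Real.log ‖w - bpt a‖ := by
  have h := circleAverage_re_herglotzRieszKernel_mul_log (c := 0) (R := 1) (w := w) (ρ := bpt a)
    (by simp) hw
  rw [← h, Real.circleAverage, poissonExt, smul_eq_mul, one_div]
  congr 1
  refine intervalIntegral.integral_congr fun t _ => ?_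
  rw [Pi.mul_apply, ← poissonKernel_eq_re_herglotzRieszKernel, poissonKernel_def,
    ← bpt_eq_circleMap]
  simp

/-- The logarithm of the modulus of the arc polynomial on the circle. -/
def logArcPoly (a b t : ℝ) : ℝ := Real.log ‖bpt t - bpt a‖ + Real.log ‖bpt t - bpt b‖

lemma per_logArcPoly (a b : ℝ) : Per (logArcPoly a b) :=
  (per_log_norm_bpt_sub a).add (per_log_norm_bpt_sub b)

lemma arcPoly_ne_zero (a b : ℝ) {z : ℂ} (hz : z ∈ disc) : arcPoly a b z ≠ 0 :=
  mul_ne_zero (sub_ne_zero.mpr fun h => bpt_sub_ne_zero hz a (sub_eq_zero.mpr h.symm))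
    (bpt_sub_ne_zero hz b)

lemma norm_exp_herg_logArcPoly (a b : ℝ) {z : ℂ} (hz : z ∈ disc) :
    ‖Complex.exp (herg (logArcPoly a b) z)‖ = ‖arcPoly a b z‖ := by
  have h := arcPoly_ne_zero a b hz
  rw [norm_exp_herg (per_logArcPoly a b) hz]
  unfold logArcPoly
  rw [poissonExt_add (per_log_norm_bpt_sub a) (per_log_norm_bpt_sub b) hz,
    poissonExt_log_norm_bpt_sub a hz, poissonExt_log_norm_bpt_sub b hz]
  rw [arcPoly, mul_ne_zero_iff] at h
  rw [norm_sub_rev z (bpt b), Real.exp_add, Real.exp_log (norm_pos_iff.mpr h.1),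
    Real.exp_log (norm_pos_iff.mpr h.2), arcPoly, norm_mul]

lemma exists_eqOn_mul_arcPoly (a b : ℝ) :
    ∃ c : ℂ, ‖c‖ = 1 ∧ ∀ z ∈ disc, Complex.exp (herg (logArcPoly a b) z) = c * arcPoly a b z := by
  set h : ℂ → ℂ := fun z => Complex.exp (herg (logArcPoly a b) z) / arcPoly a b z with hh
  have hnorm : ∀ z ∈ disc, ‖h z‖ = 1 := fun z hz => by
    rw [hh, norm_div, norm_exp_herg_logArcPoly a b hz,
      div_self (norm_ne_zero_iff.mpr (arcPoly_ne_zero a b hz))]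
  have hd : DifferentiableOn ℂ h disc :=
    (differentiableOn_exp_herg (per_logArcPoly a b)).div
      (fun z _ => (hasDerivAt_arcPoly a b z).differentiableAt.differentiableWithinAt)
      fun z hz => arcPoly_ne_zero a b hz
  have h0 : (0 : ℂ) ∈ disc := by simp [mem_disc]
  have hconst := Complex.eqOn_of_isPreconnected_of_isMaxOn_norm
    (convex_ball (0 : ℂ) 1).isPreconnected Metric.isOpen_ball hd h0
    fun z hz => by simp [hnorm z hz, hnorm 0 h0]
  refine ⟨h 0, hnorm 0 h0, fun z hz => ?_⟩
  have := hconst hz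
  simp only [Function.const_apply] at this
  rw [← this, hh]
  exact (div_mul_cancel₀ _ (arcPoly_ne_zero a b hz)).symm

lemma dirA_const_mul {F : ℂ → ℂ} (hF : DifferentiableOn ℂ F disc) {c : ℂ} (hc : ‖c‖ = 1) (w : ℂ) :
    dirA (fun z => c * F z) w = dirA F w := by
  refine setLIntegral_congr_fun measurableSet_disc fun z hz => ?_
  rw [deriv_const_mul _ (hF.differentiableAt (Metric.isOpen_ball.mem_nhds hz)), norm_mul, hc,
    one_mul]

lemma ae_bpt_ne (a : ℝ) : ∀ᵐ t ∂θm, bpt t ≠ bpt a := by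
  have h : ∀ᵐ t ∂θm, t ≠ posArg (bpt a) := by
    refine ae_restrict_of_ae ?_
    simp [ae_iff]
  filter_upwards [h, ae_θm_mem] with t h1 h2 h3
  exact h1 (by rw [← h3, posArg_bpt h2])

lemma memHardy2_of_memHinf {F : ℂ → ℂ} (hF : MemHinf F) : MemHardy2 F := by
  obtain ⟨hd, C, hC⟩ := hF
  refine ⟨hd, C ^ 2, ?_⟩
  rintro x ⟨r, hr0, hr1, rfl⟩
  have h := intervalIntegral.norm_integral_le_of_norm_le_const (a := 0) (b := 2 * Real.pi)
    (f := fun t => ‖F ((r : ℂ) * bpt t)‖ ^ 2) (C := C ^ 2) fun t _ => by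
      rw [norm_pow, norm_norm]
      exact pow_le_pow_left₀ (norm_nonneg _) (hC _ (smul_bpt_mem_disc ⟨hr0, hr1⟩ t)) 2
  rw [sub_zero, abs_of_pos Real.two_pi_pos] at h
  have h2 := (le_abs_self _).trans h
  rw [one_div, inv_mul_le_iff₀ Real.two_pi_pos]
  linarith

lemma exists_ae_le_of_norm_le {f : ℂ → ℂ} {u : ℝ → ℝ} (hu : Per u)
    (hf : ∀ z ∈ disc, f z = Complex.exp (herg u z)) {C : ℝ} (hC : ∀ z ∈ disc, ‖f z‖ ≤ C) :
    ∃ M, 0 ≤ M ∧ ∀ᵐ t ∂θm, u t ≤ M := by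
  refine ⟨Real.log (max C 1), Real.log_nonneg (le_max_right _ _), ?_⟩
  obtain ⟨ρ, hρ, hρt, h⟩ := exists_radii_tendsto_norm_exp_herg hu
  filter_upwards [h] with t ht
  rw [Real.le_log_iff_exp_le (by positivity)]
  refine (le_of_tendsto' ht fun n => ?_).trans (le_max_left _ _)
  have hw := smul_bpt_mem_disc (hρ n) t
  rw [← hf _ hw]
  exact hC _ hw

lemma ae_boundaryAbs_eq {f : ℂ → ℂ} {u : ℝ → ℝ} (hu : Per u)
    (hf : ∀ z ∈ disc, f z = Complex.exp (herg u z)) :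
    ∀ᵐ t ∂θm, ∀ m, BoundaryAbs f t m → m = Real.exp (u t) := by
  obtain ⟨ρ, hρ, hρt, h⟩ := exists_radii_tendsto_norm_exp_herg hu
  filter_upwards [h] with t ht m hm
  refine tendsto_nhds_unique (hm.comp (tendsto_nhdsWithin_iff.mpr
    ⟨hρt, Eventually.of_forall fun n => (hρ n).2⟩)) ?_
  refine ht.congr fun n => ?_
  rw [Function.comp_apply, hf _ (smul_bpt_mem_disc (hρ n) t)]

/-- **Arc modification lemma.** For an open arc `V = (e^{ia}, e^{ib})` and an outer
`f ∈ D(μ) ∩ H^∞`, the outer function `f_V` with boundary modulus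
`|(ζ - e^{ia})(e^{ib} - ζ)||f(ζ)|` on `V̄` and `|(ζ - e^{ia})(e^{ib} - ζ)|` off `V̄`
belongs to `D(μ) ∩ H^∞`. -/
theorem arc_modification
    (μ : Measure ℂ) [IsFiniteMeasure μ] (hμ : OnCircle μ)
    (a b : ℝ) (hab : a < b) (hb : b < a + 2 * Real.pi)
    (f fV : ℂ → ℂ) (φ : ℝ → ℝ)
    (hfD : MemD μ f) (hfH : MemHinf f) (hfO : IsOuter f)
    (hfVO : OuterWith fV φ)
    (hφ : ∀ᵐ t ∂θm,
      (bpt t ∈ {ζ : ℂ | ∃ s : ℝ, a ≤ s ∧ s ≤ b ∧ ζ = bpt s} →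
        ∃ m : ℝ, BoundaryAbs f t m ∧
          φ t = ‖(bpt t - bpt a) * (bpt b - bpt t)‖ * m) ∧
      (bpt t ∉ {ζ : ℂ | ∃ s : ℝ, a ≤ s ∧ s ≤ b ∧ ζ = bpt s} →
        φ t = ‖(bpt t - bpt a) * (bpt b - bpt t)‖)) :
    MemD μ fV ∧ MemHinf fV := by
  change ∀ᵐ t ∂θm, (bpt t ∈ arc a b → ∃ m : ℝ, BoundaryAbs f t m ∧
    φ t = ‖arcPoly a b (bpt t)‖ * m) ∧ (bpt t ∉ arc a b → φ t = ‖arcPoly a b (bpt t)‖) at hφ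
  obtain ⟨φf, -, hu, hf⟩ := hfO
  obtain ⟨-, -, hfV⟩ := hfVO
  set u : ℝ → ℝ := fun t => Real.log (φf t)
  replace hu : Per u := hu
  replace hf : ∀ z ∈ disc, f z = Complex.exp (herg u z) := hf
  obtain ⟨C, hC⟩ := hfH.2
  obtain ⟨M, hM0, hM⟩ := exists_ae_le_of_norm_le hu hf hC
  set Q := (bpt ⁻¹' arc a b).indicator u with hQdef
  have hQ : Per Q := per_indicator hu (measurableSet_preimage_arc a b)
  have hQM : ∀ᵐ t ∂θm, Q t ≤ M := indicator_le_of_le hM0 hM _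
  have hlog : ∀ᵐ t ∂θm, Real.log (φ t) = logArcPoly a b t + Q t := by
    filter_upwards [hφ, ae_boundaryAbs_eq hu hf, ae_bpt_ne a, ae_bpt_ne b] with t h hm ha hb
    have ha' := norm_ne_zero_iff.mpr (sub_ne_zero.mpr ha)
    have hb' := norm_ne_zero_iff.mpr (sub_ne_zero.mpr hb)
    have hp : ‖arcPoly a b (bpt t)‖ = ‖bpt t - bpt a‖ * ‖bpt t - bpt b‖ := by
      rw [arcPoly, norm_mul, norm_sub_rev (bpt b)]
    by_cases ht : bpt t ∈ arc a b
    · obtain ⟨m, hbm, hφt⟩ := h.1 ht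
      rw [hφt, hm m hbm, hp, Real.log_mul (mul_ne_zero ha' hb') (Real.exp_pos _).ne',
        Real.log_mul ha' hb', Real.log_exp, logArcPoly, hQdef,
        indicator_of_mem (show t ∈ bpt ⁻¹' arc a b from ht)]
    · rw [h.2 ht, hp, Real.log_mul ha' hb', logArcPoly, hQdef,
        indicator_of_notMem (show t ∉ bpt ⁻¹' arc a b from ht), add_zero]
  set g := fun z => Complex.exp (herg Q z) with hg
  have hgd : DifferentiableOn ℂ g disc := differentiableOn_exp_herg hQ
  have hgb : ∀ z ∈ disc, ‖g z‖ ≤ Real.exp M := fun z hz => norm_exp_herg_le hQ hQM hz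
  obtain ⟨c, hc, hcp⟩ := exists_eqOn_mul_arcPoly a b
  have hfVg : EqOn fV (fun z => c * (arcPoly a b z * g z)) disc := by
    intro z hz
    have h : fV z = Complex.exp (herg (fun t => Real.log (φ t)) z) := hfV z hz
    rw [h, herg_congr hlog, herg_add (per_logArcPoly a b) hQ hz, Complex.exp_add, hcp z hz,
      mul_assoc]
  have hpg : DifferentiableOn ℂ (fun z => arcPoly a b z * g z) disc :=
    DifferentiableOn.mul (fun z _ =>
      (hasDerivAt_arcPoly a b z).differentiableAt.differentiableWithinAt) hgd
  have hH : MemHinf fV := by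
    refine ⟨(hpg.const_mul c).congr hfVg, 4 * Real.exp M, fun z hz => ?_⟩
    rw [hfVg hz, norm_mul, norm_mul, hc, one_mul]
    exact mul_le_mul (norm_arcPoly_le a b (mem_disc.mp hz).le) (hgb z hz) (norm_nonneg _)
      (by norm_num)
  refine ⟨⟨memHardy2_of_memHinf hH, ?_⟩, hH⟩
  have hfA := (integrableOn_dirichletDensity_iff hμ f).mp hfD.2
  rw [integrableOn_dirichletDensity_iff hμ]
  obtain ⟨K, hK⟩ := normSq_arcPoly_mul_dirA_le hu hM0 hM a b
  have hg0 : dirA g 0 ≠ ∞ := by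
    have h := dirA_exp_herg_le hQ (per_exp_two_mul hQ hQM) (w := 0) (by simp [mem_disc])
    rw [norm_zero, zero_pow two_ne_zero, sub_zero, ENNReal.ofReal_one, one_mul] at h
    exact ne_top_of_le_ne_top ENNReal.ofReal_ne_top h
  set L := 4 * ENNReal.ofReal K + 64 * dirA g 0 +
    ENNReal.ofReal (32 * Real.exp M ^ 2) * ENNReal.ofReal Real.pi with hL
  have hLtop : L ≠ ∞ := by finiteness
  have hae : ∀ᵐ ζ ∂μ, ζ ∈ circleT := by rw [ae_iff]; exact hμ
  have hbound : ∀ᵐ ζ ∂μ, dirA fV ζ ≤ 2048 * dirA f ζ + L := by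
    filter_upwards [hae] with ζ hζ
    have hζ1 : ‖ζ‖ = 1 := by simpa [circleT] using hζ
    rw [dirA_congr hfVg, dirA_const_mul hpg hc, dirA_congr hf]
    calc dirA (fun z => arcPoly a b z * g z) ζ
        ≤ 4 * (ENNReal.ofReal (‖arcPoly a b ζ‖ ^ 2) * dirA g ζ) + 64 * dirA g 0 +
          ENNReal.ofReal (32 * Real.exp M ^ 2) * ENNReal.ofReal Real.pi :=
          dirA_arcPoly_mul_le hgd hgb a b hζ1
      _ ≤ 4 * (512 * dirA (fun z => Complex.exp (herg u z)) ζ + ENNReal.ofReal K) +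
          64 * dirA g 0 + ENNReal.ofReal (32 * Real.exp M ^ 2) * ENNReal.ofReal Real.pi :=
          add_le_add_left (add_le_add_left (mul_le_mul_right (hK ζ hζ1) _) _) _
      _ = _ := by rw [hL]; ring
  refine (lintegral_mono_ae hbound).trans_lt ?_
  rw [lintegral_add_right _ measurable_const, lintegral_const_mul' _ _ (by norm_num),
    lintegral_const]
  have := measure_ne_top μ Set.univ
  have := hfA.ne
  finiteness

end DirichletMu
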